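/- arXiv:math/0301293 — 2 statements merged into one kernel-verified Lean document; each statement's English description precedes it below -/
import Mathlib

section
/- Let f : X → Y be a perfect surjective map between metrizable spaces, K a closed convex subset of a Banach space E, and for every y ∈ Y let 𝒞(y) ⊆ C*(X, K) be a set such that whenever h ∈ C*(X, K) restricts on f⁻¹(y) to the same map as some g ∈ 𝒞(y), then h ∈ 𝒞(y); let ψ(y) = C*(X, K) ∖ 𝒞(y). Suppose Y is a C-space (respectively, dim Y ≤ m) and that: (a) the set-valued map ψ has a closed graph (with C*(X, K) carrying the uniform convergence topology); and (b) for every continuous α : X → (0,∞), every y ∈ Y and every g ∈ C*(X, K), the set ψ(y) ∩ B̄(g, α) is a Z-set (respectively, a Z_m-set) in B̄(g, α), where B̄(g, α) is considered as a subspace of C*(X, K) with the uniform convergence topology. Then 𝒞(Y) = ∩_{y ∈ Y} 𝒞(y) is dense in C*(X, K) with respect to the source limitation topology. -/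
open Set Topology Metric BoundedContinuousFunction

noncomputable section

/-- Covering dimension at most `n` (for a natural number `n`): every finite open cover
has an open refinement covering the space such that every point belongs to at most
`n + 1` members of the refinement. -/
def CovDimLENat (X : Type*) [TopologicalSpace X] (n : ℕ) : Prop :=
  ∀ 𝒰 : Set (Set X), 𝒰.Finite → (∀ U ∈ 𝒰, IsOpen U) → ⋃₀ 𝒰 = Set.univ →
    ∃ 𝒱 : Set (Set X), (∀ V ∈ 𝒱, IsOpen V) ∧ ⋃₀ 𝒱 = Set.univ ∧
      (∀ V ∈ 𝒱, ∃ U ∈ 𝒰, V ⊆ U) ∧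
      ∀ x : X, {V ∈ 𝒱 | x ∈ V}.Finite ∧ {V ∈ 𝒱 | x ∈ V}.ncard ≤ n + 1

/-- Covering dimension at most `n` for an integer `n`; negative bounds mean the space
is empty (`dim ∅ = -1`). -/
def CovDimLE (X : Type*) [TopologicalSpace X] (n : ℤ) : Prop :=
  IsEmpty X ∨ ∃ k : ℕ, (k : ℤ) ≤ n ∧ CovDimLENat X k

/-- A space is finite-dimensional if its covering dimension is at most `n` for some `n`. -/
def FiniteDimSpace (X : Type*) [TopologicalSpace X] : Prop :=
  ∃ n : ℕ, CovDimLENat X n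

/-- A perfect map: continuous, closed, with compact fibers. -/
def IsPerfectMap {X Y : Type*} [TopologicalSpace X] [TopologicalSpace Y] (f : X → Y) : Prop :=
  Continuous f ∧ IsClosedMap f ∧ ∀ y : Y, IsCompact (f ⁻¹' {y})

/-- A σ-perfect map: `X` is a countable union of closed sets `A i` whose images are
closed and on which `f` restricts to a perfect map onto its image. -/
def IsSigmaPerfectMap {X Y : Type*} [TopologicalSpace X] [TopologicalSpace Y] (f : X → Y) :
    Prop :=
  Continuous f ∧ ∃ A : ℕ → Set X, (⋃ i, A i) = Set.univ ∧
    ∀ i, IsClosed (A i) ∧ IsClosed (f '' A i) ∧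
      IsPerfectMap (Set.MapsTo.restrict f (A i) (f '' A i) (Set.mapsTo_image f (A i)))

/-- `dim f ≤ k`: every fiber of `f` has covering dimension at most `k`. -/
def DimMapLE {X Y : Type*} [TopologicalSpace X] [TopologicalSpace Y] (f : X → Y) (k : ℤ) :
    Prop :=
  ∀ y : Y, CovDimLE (f ⁻¹' {y}) k

/-- `B_n(h)`: the set of points of the codomain having at least `n` preimages. -/
def BranchSet {X Z : Type*} (h : X → Z) (n : ℕ) : Set Z :=
  {z | ∃ S : Finset X, n ≤ S.card ∧ ∀ x ∈ S, h x = z}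

/-- The source limitation topology on the space of bounded continuous maps. -/
def sourceLimitation (X E : Type*) [TopologicalSpace X] [PseudoMetricSpace E] :
    TopologicalSpace (X →ᵇ E) where
  IsOpen U := ∀ g ∈ U, ∃ α : X → ℝ, Continuous α ∧ (∀ x, 0 < α x) ∧
    ∀ h : X →ᵇ E, (∀ x, dist (h x) (g x) ≤ α x) → h ∈ U
  isOpen_univ := fun g _ =>
    ⟨fun _ => 1, continuous_const, fun _ => one_pos, fun _ _ => trivial⟩
  isOpen_inter := by
    rintro U V hU hV g ⟨hgU, hgV⟩
    obtain ⟨α, hαc, hαp, hα⟩ := hU g hgU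
    obtain ⟨β, hβc, hβp, hβ⟩ := hV g hgV
    exact ⟨fun x => min (α x) (β x), hαc.min hβc, fun x => lt_min (hαp x) (hβp x),
      fun h hh => ⟨hα h fun x => (hh x).trans (min_le_left _ _),
        hβ h fun x => (hh x).trans (min_le_right _ _)⟩⟩
  isOpen_sUnion := by
    rintro S hS g ⟨U, hU, hgU⟩
    obtain ⟨α, hc, hp, h⟩ := hS U hU g hgU
    exact ⟨α, hc, hp, fun h' hh' => ⟨U, hU, h h' hh'⟩⟩

/-- A C-space. -/
def IsCSpace (Y : Type*) [TopologicalSpace Y] : Prop :=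
  ∀ 𝒰 : ℕ → Set (Set Y), (∀ n, (∀ U ∈ 𝒰 n, IsOpen U) ∧ ⋃₀ 𝒰 n = Set.univ) →
    ∃ 𝒱 : ℕ → Set (Set Y),
      (∀ n, (∀ V ∈ 𝒱 n, IsOpen V) ∧ (∀ V ∈ 𝒱 n, ∃ U ∈ 𝒰 n, V ⊆ U) ∧
        (𝒱 n).Pairwise (Disjoint · ·)) ∧
      ⋃₀ (⋃ n, 𝒱 n) = Set.univ

/-- `F` is a `Z_m`-set in `M`: `F` is closed and the maps from the `m`-cube avoiding `F`
are dense in `C(𝕀^m, M)` (uniform convergence topology). -/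
def IsZmSet (m : ℕ) {M : Type*} [TopologicalSpace M] (F : Set M) : Prop :=
  IsClosed F ∧ Dense {u : C((Fin m → unitInterval), M) | ∀ z, u z ∉ F}

/-- `F` is a `Z`-set in `M` if it is a `Z_m`-set for all `m`. -/
def IsZSet {M : Type*} [TopologicalSpace M] (F : Set M) : Prop :=
  ∀ m : ℕ, IsZmSet m F

end


/-! ### Abstract convex combinations and avoidance -/

structure MixStr (M : Type*) [MetricSpace M] where
  mix : unitInterval → M → M → M
  cont : Continuous fun p : unitInterval × M × M => mix p.1 p.2.1 p.2.2
  zero : ∀ a b, mix 0 a b = a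
  one : ∀ a b, mix 1 a b = b
  dist_le : ∀ t a b, dist (mix t a b) a ≤ dist b a

def ApprAvoid (n : ℕ) {M : Type*} [MetricSpace M] (F : Set M) : Prop :=
  ∀ u : C((Fin n → unitInterval), M), ∀ ε > 0, ∃ v : C((Fin n → unitInterval), M),
    (∀ z, dist (v z) (u z) < ε) ∧ ∀ z, v z ∉ F

theorem IsZmSet.appr {m : ℕ} {M : Type*} [MetricSpace M] {F : Set M} (h : IsZmSet m F) :
    ApprAvoid m F := by
  intro u ε hε
  obtain ⟨v, hv, hd⟩ := Metric.dense_iff.1 h.2 u ε hε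
  exact ⟨v, (ContinuousMap.dist_lt_iff hε).1 hv, hd⟩

theorem ApprAvoid.mono {m n : ℕ} {M : Type*} [MetricSpace M] {F : Set M} (h : ApprAvoid m F)
    (hnm : n ≤ m) : ApprAvoid n F := by
  intro u ε hε
  let pr : C((Fin m → unitInterval), (Fin n → unitInterval)) :=
    ⟨fun t i => t (Fin.castLE hnm i), by fun_prop⟩
  let ic : C((Fin n → unitInterval), (Fin m → unitInterval)) :=
    ⟨fun t i => if h : (i : ℕ) < n then t ⟨i, h⟩ else 0, by
      refine continuous_pi fun i => ?_
      by_cases h : (i : ℕ) < n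
      · simp only [h, dite_true]; fun_prop
      · simp only [h, dite_false]; fun_prop⟩
  obtain ⟨v, hv, hd⟩ := h (u.comp pr) ε hε
  refine ⟨v.comp ic, fun z => ?_, fun z => hd _⟩
  have := hv (ic z)
  have hz : pr (ic z) = z := by
    ext i
    simp [pr, ic]
  simpa [hz] using this

theorem exists_eps_of_compact {M : Type*} [MetricSpace M] {C F : Set M} (hC : IsCompact C)
    (hF : IsClosed F) (hd : ∀ x ∈ C, x ∉ F) :
    ∃ ε > 0, ∀ x ∈ C, ∀ y, dist y x < ε → y ∉ F := by
  obtain ⟨ε, hε, h⟩ := hC.exists_thickening_subset_open hF.isOpen_compl hd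
  exact ⟨ε, hε, fun x hx y hy => h (mem_thickening_iff.2 ⟨x, hx, hy⟩)⟩

theorem approx_finset {P M J : Type*} [TopologicalSpace P] [CompactSpace P] [T2Space P]
    [MetricSpace M] (mx : MixStr M) {F : Set M} (hF : IsClosed F) {n : ℕ} (hZ : ApprAvoid n F)
    (e : J → C((Fin n → unitInterval), P)) (p : J → C(P, (Fin n → unitInterval)))
    (H : C(P, M)) (S : Finset J) : ∀ ε > 0,
    ∃ G : C(P, M), (∀ t, dist (G t) (H t) < ε) ∧ ∀ j ∈ S, ∀ t, e j (p j t) = t → G t ∉ F := by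
  classical
  induction S using Finset.induction_on with
  | empty => intro ε hε; exact ⟨H, fun t => by simpa using hε, by simp⟩
  | insert j S hj ih =>
    intro ε hε
    obtain ⟨G, hG, hGF⟩ := ih (ε / 2) (by positivity)
    have hcl : IsClosed (⋃ k ∈ S, {t | e k (p k t) = t}) := by
      refine S.finite_toSet.isClosed_biUnion fun k _ => ?_
      exact isClosed_eq (by fun_prop) continuous_id
    obtain ⟨d, hd, hdF⟩ := exists_eps_of_compact (hcl.isCompact.image G.continuous) hF (by
      rintro _ ⟨t, ht, rfl⟩
      simp only [mem_iUnion, mem_ofPred_eq] at ht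
      obtain ⟨k, hk, hkt⟩ := ht
      exact hGF k hk t hkt)
    set δ := min (ε / 4) (d / 4) with hδ
    have hδ0 : 0 < δ := by positivity
    have hδ1 : δ ≤ ε / 4 := min_le_left _ _
    have hδ2 : δ ≤ d / 4 := min_le_right _ _
    obtain ⟨v, hv, hvF⟩ := hZ (G.comp (e j)) δ hδ0
    let μ : P → unitInterval := fun t =>
      Set.projIcc 0 1 zero_le_one (1 - dist (G t) (G (e j (p j t))) / δ)
    have hμ : Continuous μ := continuous_projIcc.comp (by fun_prop)
    let G' : C(P, M) := ⟨fun t => mx.mix (μ t) (G t) (v (p j t)),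
      mx.cont.comp (hμ.prodMk (G.continuous.prodMk (by fun_prop)))⟩
    have key : ∀ t, dist (G' t) (G t) < 2 * δ := by
      intro t
      by_cases h : dist (G t) (G (e j (p j t))) < δ
      · calc dist (G' t) (G t) ≤ dist (v (p j t)) (G t) := mx.dist_le _ _ _
          _ ≤ dist (v (p j t)) (G (e j (p j t))) + dist (G (e j (p j t))) (G t) :=
            dist_triangle _ _ _
          _ < δ + δ := by
            rw [dist_comm (G (e j (p j t)))]
            exact add_lt_add (hv _) h
          _ = 2 * δ := by ring
      · have : μ t = 0 := by
          apply Set.projIcc_of_le_left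
          have : 1 ≤ dist (G t) (G (e j (p j t))) / δ := by
            rw [le_div_iff₀ hδ0]; linarith
          linarith
        have h2 : G' t = G t := by
          change mx.mix (μ t) (G t) _ = _
          rw [this, mx.zero]
        rw [h2, dist_self]; positivity
    refine ⟨G', fun t => ?_, fun k hk t hkt => ?_⟩
    · have := dist_triangle (G' t) (G t) (H t)
      have := key t
      have := hG t
      linarith
    · rcases Finset.mem_insert.1 hk with rfl | hk
      · have : μ t = 1 := by
          apply Set.projIcc_of_right_le
          simp [hkt]
        change mx.mix (μ t) (G t) _ ∉ F
        rw [this, mx.one]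
        exact hvF _
      · refine hdF (G t) (mem_image_of_mem _ ?_) _ ?_
        · simp only [mem_iUnion, mem_ofPred_eq]; exact ⟨k, hk, hkt⟩
        · have := key t; linarith

theorem eventually_avoid {Y M : Type*} [TopologicalSpace Y] [MetricSpace M]
    {ψ : Y → Set M} (hgr : IsClosed {q : Y × M | q.2 ∈ ψ q.1}) {C : Set M} (hC : IsCompact C)
    {a : Y} (h : ∀ x ∈ C, x ∉ ψ a) : ∀ᶠ y in 𝓝 a, ∀ x ∈ C, x ∉ ψ y := by
  refine hC.eventually_forall_of_forall_eventually fun x hx => ?_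
  exact hgr.isOpen_compl.mem_nhds (h x hx)

/-! ### The parameter space -/

def Par (Y : Type*) : Type _ :=
  {t : ℕ → Y → unitInterval // ∀ n z z', z ≠ z' → t n z = 0 ∨ t n z' = 0}

namespace Par

variable {Y : Type*}

instance : TopologicalSpace (Par Y) :=
  inferInstanceAs (TopologicalSpace {t : ℕ → Y → unitInterval // _})

instance : T2Space (Par Y) :=
  inferInstanceAs (T2Space {t : ℕ → Y → unitInterval // _})

theorem cont_coord (i : ℕ) (z : Y) : Continuous fun t : Par Y => t.1 i z := by
  exact (continuous_apply z).comp ((continuous_apply i).comp continuous_subtype_val)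

theorem cont_mk {T : Type*} [TopologicalSpace T] {g : T → Par Y}
    (h : ∀ i z, Continuous fun x => (g x).1 i z) : Continuous g :=
  Continuous.subtype_mk (continuous_pi fun i => continuous_pi fun z => h i z) _

instance : CompactSpace (Par Y) := by
  suffices h : IsClosed {t : ℕ → Y → unitInterval | ∀ n z z', z ≠ z' → t n z = 0 ∨ t n z' = 0} from
    isCompact_iff_compactSpace.1 h.isCompact
  have : {t : ℕ → Y → unitInterval | ∀ n z z', z ≠ z' → t n z = 0 ∨ t n z' = 0} =
      ⋂ n, ⋂ z, ⋂ z', ⋂ (_ : z ≠ z'), ({t | t n z = 0} ∪ {t | t n z' = 0}) := by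
    ext t; simp
  rw [this]
  refine isClosed_iInter fun n => isClosed_iInter fun z => isClosed_iInter fun z' =>
    isClosed_iInter fun _ => ?_
  exact (isClosed_eq (by fun_prop) continuous_const).union
    (isClosed_eq (by fun_prop) continuous_const)

open Classical in
/-- Keep only the coordinates in a set. -/
noncomputable def res (A : Set (ℕ × Y)) (t : Par Y) : Par Y :=
  ⟨fun i z => if (i, z) ∈ A then t.1 i z else 0, fun n z z' h => by
    rcases t.2 n z z' h with h | h
    · left; simp [h]
    · right; simp [h]⟩

open Classical in
theorem res_apply (A : Set (ℕ × Y)) (t : Par Y) (i : ℕ) (z : Y) :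
    (res A t).1 i z = if (i, z) ∈ A then t.1 i z else 0 := rfl

theorem cont_res (A : Set (ℕ × Y)) : Continuous (res A) := by
  classical
  refine cont_mk fun i z => ?_
  simp only [res_apply]
  split_ifs
  · exact cont_coord i z
  · exact continuous_const

theorem ext' {t t' : Par Y} (h : ∀ i z, t.1 i z = t'.1 i z) : t = t' :=
  Subtype.ext (funext fun i => funext fun z => h i z)

theorem res_eq_self {A : Set (ℕ × Y)} {t : Par Y} (h : ∀ i z, t.1 i z ≠ 0 → (i, z) ∈ A) :
    res A t = t := by
  classical
  refine ext' fun i z => ?_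
  rw [res_apply]
  split_ifs with h1
  · rfl
  · by_contra h2
    exact h1 (h i z fun h3 => h2 h3.symm)

theorem res_res (A B : Set (ℕ × Y)) (t : Par Y) : res A (res B t) = res (A ∩ B) t := by
  classical
  refine ext' fun i z => ?_
  simp only [res_apply, mem_inter_iff]
  split_ifs <;> first | rfl | tauto

/-- The coordinates at levels `< n` with index in `Z`. -/
def box (n : ℕ) (Z : Set Y) : Set (ℕ × Y) := {w | w.1 < n ∧ w.2 ∈ Z}

open Classical in
/-- inclusion of a cube -/
noncomputable def inc (n : ℕ) (c : Fin n → Y) : C((Fin n → unitInterval), Par Y) :=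
  ⟨fun u => ⟨fun i z => if h : i < n then (if z = c ⟨i, h⟩ then u ⟨i, h⟩ else 0) else 0, by
      intro k z z' hz
      by_cases h : k < n
      · simp only [h, dite_true]
        by_cases h1 : z = c ⟨k, h⟩
        · right; rw [if_neg]; rintro rfl; exact hz h1
        · left; rw [if_neg h1]
      · simp [h]⟩, by
    refine cont_mk fun i z => ?_
    by_cases h : i < n
    · simp only [h, dite_true]
      split_ifs <;> fun_prop
    · simp only [h, dite_false]; fun_prop⟩

noncomputable def prj (n : ℕ) (c : Fin n → Y) : C(Par Y, (Fin n → unitInterval)) :=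
  ⟨fun t i => t.1 i (c i), continuous_pi fun i => cont_coord _ _⟩

theorem inc_prj (n : ℕ) (c : Fin n → Y) (t : Par Y)
    (h : ∀ i z, t.1 i z ≠ 0 → ∃ h : i < n, z = c ⟨i, h⟩) : inc n c (prj n c t) = t := by
  classical
  refine ext' fun i z => ?_
  change (if h : i < n then (if z = c ⟨i, h⟩ then t.1 i (c ⟨i, h⟩) else 0) else 0) = _
  by_cases h0 : t.1 i z = 0
  · rw [h0]
    split_ifs with h1 h2
    · rw [← h2, h0]
    · rfl
    · rfl
  · obtain ⟨h1, h2⟩ := h i z h0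
    rw [dif_pos h1, if_pos h2, ← h2]

theorem exists_prj (n : ℕ) (Z : Finset Y) (a : Y) (ha : a ∈ Z) (t : Par Y)
    (h : ∀ i z, t.1 i z ≠ 0 → i < n ∧ z ∈ Z) :
    ∃ c : Fin n → Z, inc n (fun i => (c i : Y)) (prj n (fun i => (c i : Y)) t) = t := by
  have : ∀ i : Fin n, ∃ w : Z, ∀ z, t.1 i z ≠ 0 → z = w := by
    intro i
    by_cases h1 : ∃ z, t.1 i z ≠ 0
    · obtain ⟨z, hz⟩ := h1
      refine ⟨⟨z, (h i z hz).2⟩, fun z' hz' => ?_⟩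
      by_contra hne
      rcases t.2 i z' z hne with h2 | h2
      · exact hz' h2
      · exact hz h2
    · push Not at h1
      exact ⟨⟨a, ha⟩, fun z hz => absurd (h1 z) hz⟩
  choose c hc using this
  exact ⟨c, inc_prj _ _ _ fun i z hz => ⟨(h i z hz).1, hc ⟨i, (h i z hz).1⟩ z hz⟩⟩

end Par

/-! ### The inductive construction -/

structure Stage (Y M : Type*) where
  H : Par Y → M
  K : ℕ → Y → Set Y

structure Stage.Good {Y M : Type*} [TopologicalSpace Y] [MetricSpace M] (ψ : Y → Set M)
    (n : ℕ) (S : Stage Y M) : Prop where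
  cont : ∀ Z : Finset Y, Continuous fun t => S.H (Par.res (Par.box n Z) t)
  closed : ∀ i < n, ∀ z, IsClosed (S.K i z)
  lf : ∀ i < n, LocallyFinite (S.K i)
  avoid : ∀ y t, (∀ i z, t.1 i z ≠ 0 → i < n ∧ y ∈ S.K i z) → (∃ i z, t.1 i z = 1) →
    S.H t ∉ ψ y

/-- the local step -/
theorem Stage.local_step {Y M : Type*} [TopologicalSpace Y] [MetricSpace M] (mx : MixStr M)
    {ψ : Y → Set M} (hgr : IsClosed {q : Y × M | q.2 ∈ ψ q.1}) (hcl : ∀ y, IsClosed (ψ y))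
    {n : ℕ} {S : Stage Y M} (hS : S.Good ψ n) (hZ : ∀ y, ApprAvoid n (ψ y)) (a : Y) :
    ∃ G : C(Par Y, M), ∀ᶠ y in 𝓝 a, ∀ t : Par Y, (∀ i z, t.1 i z ≠ 0 → i < n ∧ y ∈ S.K i z) →
      G t ∉ ψ y ∧ ((∃ i z, t.1 i z = 1) → ∀ τ, mx.mix τ (S.H t) (G t) ∉ ψ y) := by
  classical
  -- the finite set of relevant vertices
  set F : Set (ℕ × Y) := {w | w.1 < n ∧ a ∈ S.K w.1 w.2} with hFdef
  have hFfin : F.Finite := by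
    have : F ⊆ ⋃ i ∈ Finset.range n, (fun z => (i, z)) '' {z | a ∈ S.K i z} := by
      rintro ⟨i, z⟩ ⟨h1, h2⟩
      simp only [mem_iUnion, Finset.mem_range]
      exact ⟨i, h1, z, h2, rfl⟩
    refine Set.Finite.subset (Set.Finite.biUnion (Finset.finite_toSet _) fun i hi => ?_) this
    exact ((hS.lf i (by simpa using hi)).point_finite a).image _
  set Z : Finset Y := insert a (hFfin.toFinset.image Prod.snd) with hZdef
  have hFZ : ∀ i z, (i, z) ∈ F → z ∈ Z := by
    intro i z h
    refine Finset.mem_insert_of_mem (Finset.mem_image.2 ⟨(i, z), ?_, rfl⟩)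
    simpa using h
  let Hc : C(Par Y, M) := ⟨fun t => S.H (Par.res (Par.box n Z) t), hS.cont Z⟩
  have hHc : ∀ t : Par Y, (∀ i z, t.1 i z ≠ 0 → (i, z) ∈ F) → Hc t = S.H t := by
    intro t ht
    change S.H _ = _
    rw [Par.res_eq_self]
    intro i z h
    exact ⟨(ht i z h).1, hFZ _ _ (ht i z h)⟩
  set PF : Set (Par Y) := {t | ∀ i z, (i, z) ∉ F → t.1 i z = 0} with hPF
  have hPFcl : IsClosed PF := by
    have : PF = ⋂ i, ⋂ z, ⋂ (_ : (i, z) ∉ F), {t : Par Y | t.1 i z = 0} := by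
      ext t; simp [hPF]
    rw [this]
    exact isClosed_iInter fun i => isClosed_iInter fun z => isClosed_iInter fun _ =>
      isClosed_eq (Par.cont_coord i z) continuous_const
  have hPFmem : ∀ t, t ∈ PF ↔ ∀ i z, t.1 i z ≠ 0 → (i, z) ∈ F := by
    intro t
    refine ⟨fun h i z hne => ?_, fun h i z hne => ?_⟩
    · by_contra h1; exact hne (h i z h1)
    · by_contra h1; exact hne (h i z h1)
  set A : Set (Par Y) := PF ∩ ⋃ w ∈ F, {t | t.1 w.1 w.2 = 1} with hA
  have hAcl : IsClosed A := hPFcl.inter (hFfin.isClosed_biUnion fun w _ =>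
    isClosed_eq (Par.cont_coord w.1 w.2) continuous_const)
  have hAmem : ∀ t ∈ PF, (∃ i z, t.1 i z = 1) → t ∈ A := by
    rintro t ht ⟨i, z, h⟩
    refine ⟨ht, ?_⟩
    simp only [mem_iUnion]
    exact ⟨(i, z), (hPFmem t).1 ht i z (by rw [h]; exact one_ne_zero), h⟩
  have hHA : ∀ x ∈ Hc '' A, x ∉ ψ a := by
    rintro _ ⟨t, ⟨ht, ht'⟩, rfl⟩
    rw [hHc t ((hPFmem t).1 ht)]
    refine hS.avoid a t (fun i z h => (hPFmem t).1 ht i z h) ?_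
    simp only [mem_iUnion] at ht'
    obtain ⟨w, _, hw⟩ := ht'
    exact ⟨w.1, w.2, hw⟩
  obtain ⟨ε, hε, hεF⟩ := exists_eps_of_compact (hAcl.isCompact.image Hc.continuous) (hcl a) hHA
  obtain ⟨G, hG, hGF⟩ := approx_finset mx (hcl a) (hZ a)
    (fun c : Fin n → Z => Par.inc n (fun i => (c i : Y)))
    (fun c : Fin n → Z => Par.prj n (fun i => (c i : Y))) Hc Finset.univ ε hε
  have e1 : ∀ᶠ y in 𝓝 a, ∀ x ∈ G '' PF, x ∉ ψ y := by
    refine eventually_avoid hgr (hPFcl.isCompact.image G.continuous) ?_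
    rintro _ ⟨t, ht, rfl⟩
    obtain ⟨c, hc⟩ := Par.exists_prj n Z a (Finset.mem_insert_self _ _) t fun i z h =>
      ⟨((hPFmem t).1 ht i z h).1, hFZ _ _ ((hPFmem t).1 ht i z h)⟩
    exact hGF c (Finset.mem_univ _) t hc
  have e2 : ∀ᶠ y in 𝓝 a, ∀ x ∈ (fun q : unitInterval × Par Y => mx.mix q.1 (Hc q.2) (G q.2)) ''
      (univ ×ˢ A), x ∉ ψ y := by
    refine eventually_avoid hgr ((isCompact_univ.prod hAcl.isCompact).image ?_) ?_
    · exact mx.cont.comp (continuous_fst.prodMk ((Hc.continuous.comp continuous_snd).prodMk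
        (G.continuous.comp continuous_snd)))
    · rintro _ ⟨⟨τ, t⟩, ⟨_, ht⟩, rfl⟩
      exact hεF (Hc t) (mem_image_of_mem _ ht) _ ((mx.dist_le _ _ _).trans_lt (hG t))
  have e3 : ∀ᶠ y in 𝓝 a, ∀ i ∈ Finset.range n, ∀ z, y ∈ S.K i z → a ∈ S.K i z := by
    rw [Filter.eventually_all_finset]
    intro i hi
    have hi := Finset.mem_range.1 hi
    exact (hS.lf i hi).eventually_subset (hS.closed i hi) a
  refine ⟨G, ?_⟩
  filter_upwards [e1, e2, e3] with y h1 h2 h3 t ht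
  have htPF : t ∈ PF := (hPFmem t).2 fun i z h =>
    ⟨(ht i z h).1, h3 i (Finset.mem_range.2 (ht i z h).1) z (ht i z h).2⟩
  refine ⟨h1 _ (mem_image_of_mem _ htPF), fun hone τ => ?_⟩
  rw [← hHc t ((hPFmem t).1 htPF)]
  exact h2 _ ⟨(τ, t), ⟨mem_univ _, hAmem t htPF hone⟩, rfl⟩

open Classical in
/-- the index of the nonzero coordinate at level `n` -/
noncomputable def Par.idx {Y : Type*} [Nonempty Y] (n : ℕ) (t : Par Y) : Y :=
  if h : ∃ z, t.1 n z ≠ 0 then h.choose else Classical.arbitrary Y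

theorem Par.idx_spec {Y : Type*} [Nonempty Y] (n : ℕ) (t : Par Y) (z : Y) (h : t.1 n z ≠ 0) :
    z = t.idx n := by
  have h' : ∃ z, t.1 n z ≠ 0 := ⟨z, h⟩
  unfold Par.idx
  rw [dif_pos h']
  by_contra hne
  rcases t.2 n z _ hne with h2 | h2
  · exact h h2
  · exact h'.choose_spec h2

theorem Stage.step {Y M : Type*} [TopologicalSpace Y] [Nonempty Y] [T2Space Y] [ParacompactSpace Y]
    [RegularSpace Y] [MetricSpace M] (mx : MixStr M)
    {ψ : Y → Set M} (hgr : IsClosed {q : Y × M | q.2 ∈ ψ q.1}) (hcl : ∀ y, IsClosed (ψ y))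
    {n : ℕ} (S : Stage Y M) (hS : S.Good ψ n) (D : Prop) (hZ : D → ∀ y, ApprAvoid n (ψ y)) :
    ∃ S' : Stage Y M, S'.Good ψ (n + 1) ∧ (∀ i < n, S'.K i = S.K i) ∧
      (∀ t : Par Y, (∀ i z, t.1 i z ≠ 0 → i < n) → S'.H t = S.H t) ∧
      ∃ U : Y → Set Y, (∀ z, IsOpen (U z)) ∧ (∀ z, U z ⊆ S'.K n z) ∧ (D → ⋃ z, U z = univ) := by
  classical
  by_cases hD : D
  swap
  · refine ⟨⟨fun t => S.H (Par.res (Par.box n univ) t), Function.update S.K n fun _ => ∅⟩,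
      ⟨?_, ?_, ?_, ?_⟩, ?_, ?_, fun _ => ∅, fun _ => isOpen_empty, fun _ => empty_subset _,
      fun h => absurd h hD⟩
    · intro Z
      have : ∀ t : Par Y, Par.res (Par.box n univ) (Par.res (Par.box (n + 1) Z) t) =
          Par.res (Par.box n Z) t := by
        intro t
        rw [Par.res_res]
        congr 1
        ext ⟨i, z⟩
        simp only [Par.box, mem_inter_iff, mem_ofPred_eq, mem_univ]
        constructor
        · rintro ⟨⟨h1, _⟩, _, h2⟩; exact ⟨h1, h2⟩
        · rintro ⟨h1, h2⟩; exact ⟨⟨h1, trivial⟩, by omega, h2⟩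
      simp only [this]
      exact hS.cont Z
    · intro i hi z
      by_cases h : i = n
      · subst h; simp
      · simpa [h] using hS.closed i (by omega) z
    · intro i hi
      by_cases h : i = n
      · subst h
        simp only [Function.update_self]
        intro x
        exact ⟨univ, Filter.univ_mem, by simp⟩
      · simpa [h] using hS.lf i (by omega)
    · intro y t ht hone
      have ht' : ∀ i z, t.1 i z ≠ 0 → i < n ∧ y ∈ S.K i z := by
        intro i z h
        have := ht i z h
        by_cases hi : i = n
        · subst hi; simp at this
        · simp only [hi, ne_eq, not_false_eq_true, Function.update_of_ne] at this
          exact ⟨by omega, this.2⟩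
      change S.H (Par.res _ t) ∉ _
      rw [Par.res_eq_self (A := Par.box n univ) (t := t) fun i z h => ⟨(ht' i z h).1, mem_univ _⟩]
      exact hS.avoid y t ht' hone
    · intro i hi
      simp [hi.ne]
    · intro t ht
      change S.H (Par.res _ t) = _
      rw [Par.res_eq_self (A := Par.box n univ) (t := t) fun i z h => ⟨ht i z h, mem_univ _⟩]
  · choose G hG using fun a => Stage.local_step mx hgr hcl hS (hZ hD) a
    have hO : ∀ a, ∃ O : Set Y, a ∈ O ∧ IsOpen O ∧ ∀ y ∈ closure O, ∀ t : Par Y,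
        (∀ i z, t.1 i z ≠ 0 → i < n ∧ y ∈ S.K i z) →
        G a t ∉ ψ y ∧ ((∃ i z, t.1 i z = 1) → ∀ τ, mx.mix τ (S.H t) (G a t) ∉ ψ y) := by
      intro a
      obtain ⟨C, ⟨hC, hCc⟩, hCs⟩ := (closed_nhds_basis a).mem_iff.1 (hG a)
      refine ⟨interior C, mem_interior_iff_mem_nhds.2 hC, isOpen_interior, fun y hy => ?_⟩
      exact hCs (closure_minimal interior_subset hCc hy)
    choose O hOa hOo hO using hO
    obtain ⟨U, hUo, hUc, hUlf, hUO⟩ := precise_refinement O hOo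
      (iUnion_eq_univ_iff.2 fun y => ⟨y, hOa y⟩)
    let H' : Par Y → M := fun t => mx.mix (t.1 n (t.idx n)) (S.H (Par.res (Par.box n univ) t))
      (G (t.idx n) (Par.res (Par.box n univ) t))
    have hH' : ∀ (t : Par Y) z, (∀ z', z' ≠ z → t.1 n z' = 0) → H' t = mx.mix (t.1 n z)
        (S.H (Par.res (Par.box n univ) t)) (G z (Par.res (Par.box n univ) t)) := by
      intro t z h
      by_cases h0 : t.1 n z = 0
      · have h1 : t.1 n (t.idx n) = 0 := by
          by_cases h2 : t.idx n = z
          · rw [h2, h0]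
          · exact h _ h2
        simp only [H', h1, h0, mx.zero]
      · have := t.idx_spec n z h0
        simp only [H', ← this]
    refine ⟨⟨H', Function.update S.K n fun z => closure (U z)⟩,
      ⟨?_, ?_, ?_, ?_⟩, ?_, ?_, U, hUo, ?_, fun _ => hUc⟩
    · intro Z
      have hrr : ∀ t : Par Y, Par.res (Par.box n univ) (Par.res (Par.box (n + 1) Z) t) =
          Par.res (Par.box n Z) t := by
        intro t
        rw [Par.res_res]
        congr 1
        ext ⟨i, z⟩
        simp only [Par.box, mem_inter_iff, mem_ofPred_eq, mem_univ]
        constructor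
        · rintro ⟨⟨h1, _⟩, _, h2⟩; exact ⟨h1, h2⟩
        · rintro ⟨h1, h2⟩; exact ⟨⟨h1, trivial⟩, by omega, h2⟩
      let Z' : Finset Y := insert (Classical.arbitrary Y) Z
      let Cz : Z' → Set (Par Y) := fun z =>
        {t | ∀ z', z' ≠ (z : Y) → (Par.res (Par.box (n + 1) Z) t).1 n z' = 0}
      have hCcl : ∀ z, IsClosed (Cz z) := by
        intro z
        have : Cz z = ⋂ z', ⋂ (_ : z' ≠ (z : Y)),
          {t | (Par.res (Par.box (n + 1) Z) t).1 n z' = 0} := by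
          ext t; simp [Cz]
        rw [this]
        exact isClosed_iInter fun z' => isClosed_iInter fun _ =>
          isClosed_eq ((Par.cont_coord n z').comp (Par.cont_res _)) continuous_const
      refine (locallyFinite_of_finite Cz).continuous ?_ hCcl fun z => ?_
      · refine iUnion_eq_univ_iff.2 fun t => ?_
        by_cases h : ∃ z, (Par.res (Par.box (n + 1) Z) t).1 n z ≠ 0
        · obtain ⟨z, hz⟩ := h
          have hzZ : z ∈ Z := by
            by_contra h2
            apply hz
            rw [Par.res_apply, if_neg]
            exact fun h3 => h2 h3.2
          refine ⟨⟨z, Finset.mem_insert_of_mem hzZ⟩, fun z' hz' => ?_⟩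
          rcases (Par.res (Par.box (n + 1) Z) t).2 n z' z hz' with h2 | h2
          · exact h2
          · exact absurd h2 hz
        · push Not at h
          exact ⟨⟨_, Finset.mem_insert_self _ _⟩, fun z' _ => h z'⟩
      · have : ContinuousOn (fun t : Par Y => mx.mix ((Par.res (Par.box (n + 1) Z) t).1 n (z : Y))
          (S.H (Par.res (Par.box n Z) t)) (G z (Par.res (Par.box n Z) t))) (Cz z) := by
          refine Continuous.continuousOn (mx.cont.comp (Continuous.prodMk ?_
            (Continuous.prodMk (hS.cont Z) ?_)))
          · exact (Par.cont_coord n _).comp (Par.cont_res _)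
          · exact (G z).continuous.comp (Par.cont_res _)
        refine this.congr fun t ht => ?_
        change H' _ = _
        rw [hH' _ z ht, hrr]
    · intro i hi z
      by_cases h : i = n
      · subst h; simp
      · simpa [h] using hS.closed i (by omega) z
    · intro i hi
      by_cases h : i = n
      · subst h
        simp only [Function.update_self]
        exact hUlf.closure
      · simpa [h] using hS.lf i (by omega)
    · intro y t ht hone
      change H' t ∉ _
      have hz0 : ∀ z', z' ≠ t.idx n → t.1 n z' = 0 := by
        intro z' h
        by_contra h2
        exact h (t.idx_spec n z' h2)
      set z := t.idx n with hz
      rw [hH' t z hz0]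
      set t0 := Par.res (Par.box n univ) t with ht0
      have ht0i : ∀ i z, i < n → t0.1 i z = t.1 i z := by
        intro i z hi
        rw [ht0, Par.res_apply, if_pos]
        exact ⟨hi, mem_univ _⟩
      have ht0' : ∀ i z, t0.1 i z ≠ 0 → i < n ∧ y ∈ S.K i z := by
        intro i z h
        have hi : i < n := by
          by_contra hi
          apply h
          rw [ht0, Par.res_apply, if_neg]
          exact fun h3 => hi h3.1
        have := ht i z (by rwa [← ht0i i z hi])
        simp only [hi.ne, ne_eq, not_false_eq_true, Function.update_of_ne] at this
        exact ⟨hi, this.2⟩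
      have hone' : (∃ i z, t0.1 i z = 1) ∨ t.1 n z = 1 := by
        obtain ⟨i, w, h⟩ := hone
        have hne : t.1 i w ≠ 0 := by rw [h]; exact one_ne_zero
        have h1 := (ht i w hne).1
        by_cases hi : i = n
        · subst hi
          right
          rw [hz, ← t.idx_spec i w hne, h]
        · left
          exact ⟨i, w, by rw [ht0i i w (by omega), h]⟩
      by_cases h0 : t.1 n z = 0
      · rw [h0, mx.zero]
        refine hS.avoid y t0 ht0' ?_
        rcases hone' with h | h
        · exact h
        · rw [h0] at h; exact absurd h zero_ne_one
      · have hy : y ∈ closure (U z) := by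
          have := (ht n z h0).2
          simpa using this
        have := hO z y (closure_mono (hUO z) hy) t0 ht0'
        rcases hone' with h | h
        · exact this.2 h _
        · rw [h, mx.one]; exact this.1
    · intro i hi
      simp [hi.ne]
    · intro t ht
      change H' t = _
      rw [hH' t (Classical.arbitrary Y), Par.res_eq_self (A := Par.box n univ) (t := t) fun i z h => ⟨ht i z h, mem_univ _⟩]
      · have : t.1 n (Classical.arbitrary Y) = 0 := by
          by_contra h; exact lt_irrefl _ (ht _ _ h)
        rw [this, mx.zero]
      · intro z' _
        by_contra h; exact lt_irrefl _ (ht _ _ h)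
    · intro z
      simp only [Function.update_self]
      exact subset_closure

theorem exists_selection {Y M : Type*} [TopologicalSpace Y] [Nonempty Y] [T2Space Y]
    [ParacompactSpace Y] [NormalSpace Y] [MetricSpace M] [Nonempty M] (mx : MixStr M)
    {ψ : Y → Set M} (hgr : IsClosed {q : Y × M | q.2 ∈ ψ q.1}) (hcl : ∀ y, IsClosed (ψ y))
    (D : ℕ → Prop) (hZ : ∀ n, D n → ∀ y, ApprAvoid n (ψ y))
    (hsel : ∀ U : ℕ → Y → Set Y, (∀ n z, IsOpen (U n z)) → (∀ n, D n → ⋃ z, U n z = univ) →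
      ∃ V : ℕ → Y → Set Y, (∀ n z, IsOpen (V n z)) ∧ (∀ n z, V n z ⊆ U n z) ∧
        (∀ n z z', z ≠ z' → Disjoint (V n z) (V n z')) ∧ ∀ y, ∃ n z, y ∈ V n z) :
    ∃ s : Y → M, Continuous s ∧ ∀ y, s y ∉ ψ y := by
  classical
  let S0 : Stage Y M := ⟨fun _ => Classical.arbitrary M, fun _ _ => ∅⟩
  have hS0 : S0.Good ψ 0 := by
    refine ⟨fun Z => continuous_const, fun i hi => absurd hi (by omega),
      fun i hi => absurd hi (by omega), ?_⟩
    rintro y t h ⟨i, z, h1⟩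
    have := (h i z (by rw [h1]; exact one_ne_zero)).1
    omega
  choose! nxt hG hK hH Uo using fun (n : ℕ) (S : Stage Y M) (hS : S.Good ψ n) =>
    Stage.step mx hgr hcl S hS (D n) (hZ n)
  let seq : ℕ → Stage Y M := fun n => Nat.rec S0 (fun n S => nxt n S) n
  have hseq : ∀ n, (seq n).Good ψ n := by
    intro n
    induction n with
    | zero => exact hS0
    | succ n ih => exact hG n _ ih
  have hKn : ∀ i k, (seq (i + 1 + k)).K i = (seq (i + 1)).K i := by
    intro i k
    induction k with
    | zero => rfl
    | succ k ih =>
      rw [← ih]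
      exact hK _ _ (hseq (i + 1 + k)) i (by omega)
  have hHn : ∀ n k (t : Par Y), (∀ i z, t.1 i z ≠ 0 → i < n) → (seq (n + k)).H t = (seq n).H t := by
    intro n k t ht
    induction k with
    | zero => rfl
    | succ k ih =>
      rw [← ih]
      exact hH _ _ (hseq (n + k)) t fun i z h => by have := ht i z h; omega
  choose U hUo hUK hUc using fun n => Uo n (seq n) (hseq n)
  obtain ⟨V, hVo, hVU, hVd, hVc⟩ := hsel U hUo hUc
  obtain ⟨lam, hlam⟩ := BumpCovering.exists_isSubordinate (s := (univ : Set Y)) isClosed_univ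
    (fun w : ℕ × Y => V w.1 w.2) (fun w => hVo _ _) (fun y _ => by
      obtain ⟨n, z, h⟩ := hVc y
      exact mem_iUnion.2 ⟨(n, z), h⟩)
  have hlV : ∀ n z y, lam (n, z) y ≠ 0 → y ∈ V n z := fun n z y h =>
    hlam (n, z) (subset_tsupport _ h)
  let t : Y → Par Y := fun y => ⟨fun n z => ⟨lam (n, z) y, lam.nonneg _ _, lam.le_one _ _⟩, by
    intro n z z' hz
    by_contra! h
    have h1 : y ∈ V n z := hlV n z y fun h0 => h.1 (Subtype.ext h0)
    have h2 : y ∈ V n z' := hlV n z' y fun h0 => h.2 (Subtype.ext h0)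
    exact (Set.disjoint_left.1 (hVd n z z' hz)) h1 h2⟩
  have htc : Continuous t := Par.cont_mk fun i z =>
    Continuous.subtype_mk (lam (i, z)).continuous _
  have htl : ∀ y i z, (t y).1 i z ≠ 0 → lam (i, z) y ≠ 0 := fun y i z h h0 => h (Subtype.ext h0)
  have hloc : ∀ y, ∃ N : ℕ, ∃ Z : Finset Y, ∀ᶠ y' in 𝓝 y, ∀ i z, (t y').1 i z ≠ 0 →
      i < N ∧ z ∈ Z := by
    intro y
    obtain ⟨O, hO, hfin⟩ := lam.locallyFinite y
    refine ⟨(hfin.toFinset.image Prod.fst).sup id + 1, hfin.toFinset.image Prod.snd, ?_⟩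
    filter_upwards [hO] with y' hy' i z h
    have hm : (i, z) ∈ hfin.toFinset := by
      rw [Set.Finite.mem_toFinset]
      exact ⟨y', htl y' i z h, hy'⟩
    refine ⟨Nat.lt_succ_of_le ?_, Finset.mem_image.2 ⟨_, hm, rfl⟩⟩
    exact Finset.le_sup (f := id) (Finset.mem_image.2 ⟨_, hm, rfl⟩)
  choose N Z hNZ using hloc
  have hN : ∀ y i z, (t y).1 i z ≠ 0 → i < N y := fun y i z h => ((hNZ y).self_of_nhds i z h).1
  let s : Y → M := fun y => (seq (N y)).H (t y)
  have hs : ∀ y n, (∀ i z, (t y).1 i z ≠ 0 → i < n) → s y = (seq n).H (t y) := by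
    intro y n h
    change (seq (N y)).H (t y) = _
    rw [← hHn n (N y) (t y) h, ← hHn (N y) n (t y) (hN y), add_comm]
  refine ⟨s, continuous_iff_continuousAt.2 fun y => ?_, fun y => ?_⟩
  · have h1 : Continuous fun y' => (seq (N y)).H (Par.res (Par.box (N y) (Z y)) (t y')) :=
      ((hseq (N y)).cont (Z y)).comp htc
    refine h1.continuousAt.congr ?_
    filter_upwards [hNZ y] with y' h
    rw [hs y' (N y) fun i z hh => (h i z hh).1, Par.res_eq_self]
    exact fun i z hh => h i z hh
  · refine (hseq (N y)).avoid y (t y) (fun i z h => ⟨hN y i z h, ?_⟩) ?_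
    · have hi := hN y i z h
      obtain ⟨k, hk⟩ := Nat.exists_eq_add_of_le (Nat.succ_le_of_lt hi)
      have h2 := hKn i k
      rw [← Nat.succ_eq_add_one, ← hk] at h2
      rw [h2]
      exact hUK i z (hVU i z (hlV i z y (htl y i z h)))
    · have := lam.eventuallyEq_one y (mem_univ _)
      exact ⟨(lam.ind y (mem_univ _)).1, (lam.ind y (mem_univ _)).2,
        Subtype.ext this.self_of_nhds⟩

/-! ### Disjoint families -/

theorem pieces_to_index {Y J : Type*} [TopologicalSpace Y] (Q : J → Set Y)
    (ho : ∀ j, IsOpen (Q j)) (hd : ∀ j j', j ≠ j' → Disjoint (Q j) (Q j')) (U : Y → Set Y)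
    (hU : ∀ j, ∃ z, Q j ⊆ U z) :
    ∃ V : Y → Set Y, (∀ z, IsOpen (V z)) ∧ (∀ z, V z ⊆ U z) ∧
      (∀ z z', z ≠ z' → Disjoint (V z) (V z')) ∧ ∀ j, ∀ y ∈ Q j, ∃ z, y ∈ V z := by
  choose c hc using hU
  refine ⟨fun z => ⋃ j, ⋃ (_ : c j = z), Q j, fun z => isOpen_iUnion fun j => isOpen_iUnion
    fun _ => ho j, ?_, ?_, ?_⟩
  · intro z y hy
    simp only [mem_iUnion] at hy
    obtain ⟨j, rfl, h⟩ := hy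
    exact hc j h
  · intro z z' hz
    rw [Set.disjoint_left]
    intro y hy hy'
    simp only [mem_iUnion] at hy hy'
    obtain ⟨j, rfl, h⟩ := hy
    obtain ⟨j', rfl, h'⟩ := hy'
    exact Set.disjoint_left.1 (hd j j' fun e => hz (by rw [e])) h h'
  · intro j y hy
    exact ⟨c j, by simp only [mem_iUnion]; exact ⟨j, rfl, hy⟩⟩

theorem sel_of_CSpace {Y : Type*} [TopologicalSpace Y] (hY : IsCSpace Y)
    (U : ℕ → Y → Set Y) (hUo : ∀ n z, IsOpen (U n z)) (hUc : ∀ n, ⋃ z, U n z = univ) :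
    ∃ V : ℕ → Y → Set Y, (∀ n z, IsOpen (V n z)) ∧ (∀ n z, V n z ⊆ U n z) ∧
        (∀ n z z', z ≠ z' → Disjoint (V n z) (V n z')) ∧ ∀ y, ∃ n z, y ∈ V n z := by
  obtain ⟨W, hW, hc⟩ := hY (fun n => range (U n)) fun n => ⟨by rintro _ ⟨z, rfl⟩; exact hUo n z,
    by rw [sUnion_range]; exact hUc n⟩
  have : ∀ n, ∃ V : Y → Set Y, (∀ z, IsOpen (V z)) ∧ (∀ z, V z ⊆ U n z) ∧
      (∀ z z', z ≠ z' → Disjoint (V z) (V z')) ∧ ∀ j : W n, ∀ y ∈ (j : Set Y), ∃ z, y ∈ V z := by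
    intro n
    refine pieces_to_index (fun j : W n => (j : Set Y)) (fun j => (hW n).1 j j.2) ?_ (U n) ?_
    · intro j j' h
      exact (hW n).2.2 j.2 j'.2 fun e => h (Subtype.ext e)
    · intro j
      obtain ⟨_, ⟨z, rfl⟩, h⟩ := (hW n).2.1 j j.2
      exact ⟨z, h⟩
  choose V h1 h2 h3 h4 using this
  refine ⟨V, h1, h2, h3, fun y => ?_⟩
  have hy : y ∈ ⋃₀ (⋃ n, W n) := by rw [hc]; trivial
  obtain ⟨w, hw, hyw⟩ := hy
  obtain ⟨n, hn⟩ := mem_iUnion.1 hw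
  obtain ⟨z, hz⟩ := h4 n ⟨w, hn⟩ y hyw
  exact ⟨n, z, hz⟩

/-- barycentric-type disjoint refinement -/
theorem barycentric {Y ι : Type*} [TopologicalSpace Y] [NormalSpace Y] [ParacompactSpace Y]
    [T2Space Y] (U : ι → Set Y) (hUo : ∀ i, IsOpen (U i)) (hUc : ⋃ i, U i = univ) :
    ∃ A : Finset ι → Set Y, (∀ S, IsOpen (A S)) ∧ (∀ S, ∀ s ∈ S, A S ⊆ U s) ∧
      (∀ S S', S ≠ S' → S.card = S'.card → Disjoint (A S) (A S')) ∧
      ∀ y, ∃ S, S.Nonempty ∧ y ∈ A S := by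
  classical
  obtain ⟨lam, hlam⟩ := BumpCovering.exists_isSubordinate (s := (univ : Set Y)) isClosed_univ
    U hUo (by rw [hUc])
  refine ⟨fun S => {y | ∀ s ∈ S, 0 < lam s y ∧ ∀ s' ∉ S, lam s' y < lam s y}, ?_, ?_, ?_, ?_⟩
  · intro S
    rw [isOpen_iff_mem_nhds]
    intro y hy
    obtain ⟨O, hO, hfin⟩ := lam.locallyFinite y
    have e1 : ∀ᶠ y' in 𝓝 y, ∀ s ∈ S, 0 < lam s y' := by
      rw [Filter.eventually_all_finset]
      intro s hs
      exact (lam s).continuous.continuousAt.eventually (lt_mem_nhds (hy s hs).1)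
    have e2 : ∀ᶠ y' in 𝓝 y, ∀ s ∈ S, ∀ s' ∈ hfin.toFinset, s' ∉ S → lam s' y' < lam s y' := by
      rw [Filter.eventually_all_finset]
      intro s hs
      rw [Filter.eventually_all_finset]
      intro s' _
      by_cases h : s' ∈ S
      · simp [h]
      · filter_upwards [(lam s').continuous.continuousAt.eventually_lt
          (lam s).continuous.continuousAt ((hy s hs).2 s' h)] with y' h' _ using h'
    filter_upwards [e1, e2, hO] with y' h1 h2 h3 s hs
    refine ⟨h1 s hs, fun s' hs' => ?_⟩
    by_cases h : lam s' y' = 0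
    · rw [h]; exact h1 s hs
    · exact h2 s hs s' (by rw [Set.Finite.mem_toFinset]; exact ⟨y', h, h3⟩) hs'
  · intro S s hs y hy
    exact hlam s (subset_tsupport _ (hy s hs).1.ne')
  · intro S S' hne hcard
    rw [Set.disjoint_left]
    intro y hy hy'
    obtain ⟨s, hs, hs'⟩ : ∃ s ∈ S, s ∉ S' := by
      by_contra! h
      exact hne (Finset.eq_of_subset_of_card_le h hcard.ge)
    obtain ⟨u, hu, hu'⟩ : ∃ s ∈ S', s ∉ S := by
      by_contra! h
      exact hne (Finset.eq_of_subset_of_card_le h hcard.le).symm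
    exact lt_asymm ((hy s hs).2 u hu') ((hy' u hu).2 s hs')
  · intro y
    have hfin := lam.locallyFinite.point_finite y
    refine ⟨hfin.toFinset, ⟨lam.ind y (mem_univ _), ?_⟩, ?_⟩
    · rw [Set.Finite.mem_toFinset]
      have := (lam.eventuallyEq_one y (mem_univ _)).self_of_nhds
      change lam _ y ≠ 0
      rw [this]; exact one_ne_zero
    · intro s hs
      rw [Set.Finite.mem_toFinset] at hs
      have h0 : 0 < lam s y := lt_of_le_of_ne (lam.nonneg _ _) (Ne.symm hs)
      refine ⟨h0, fun s' hs' => ?_⟩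
      rw [Set.Finite.mem_toFinset] at hs'
      have : lam s' y = 0 := by by_contra h; exact hs' h
      rwa [this]

/-- finite shrinking from covering dimension -/
theorem CovDimLENat.shrink {Y ι : Type*} [TopologicalSpace Y] {k : ℕ} (hY : CovDimLENat Y k)
    (T : Finset ι) (hT : k + 1 < T.card) (U : ι → Set Y) (hUo : ∀ i, IsOpen (U i))
    (hUc : ∀ y, ∃ i ∈ T, y ∈ U i) :
    ∃ W : ι → Set Y, (∀ i, IsOpen (W i)) ∧ (∀ i, W i ⊆ U i) ∧ (∀ y, ∃ i ∈ T, y ∈ W i) ∧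
      ∀ y, ∃ i ∈ T, y ∉ W i := by
  classical
  obtain ⟨𝒱, hVo, hVc, hVr, hVn⟩ := hY (U '' (T : Set ι)) (T.finite_toSet.image _)
    (by rintro _ ⟨i, _, rfl⟩; exact hUo i)
    (by
      rw [sUnion_image]
      ext y
      simp only [mem_iUnion, mem_univ, iff_true]
      obtain ⟨i, hi, h⟩ := hUc y
      exact ⟨i, hi, h⟩)
  have : ∀ V ∈ 𝒱, ∃ i ∈ T, V ⊆ U i := by
    intro V hV
    obtain ⟨_, ⟨i, hi, rfl⟩, h⟩ := hVr V hV
    exact ⟨i, hi, h⟩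
  have hne : Nonempty ι := by
    obtain ⟨i, _⟩ := Finset.card_pos.1 (by omega : 0 < T.card)
    exact ⟨i⟩
  choose! τ hτT hτ using this
  refine ⟨fun i => ⋃ V ∈ 𝒱, ⋃ (_ : τ V = i), V, ?_, ?_, ?_, ?_⟩
  · intro i
    exact isOpen_biUnion fun V hV => isOpen_iUnion fun _ => hVo V hV
  · intro i y hy
    simp only [mem_iUnion] at hy
    obtain ⟨V, hV, rfl, h⟩ := hy
    exact hτ V hV h
  · intro y
    have hy : y ∈ ⋃₀ 𝒱 := by rw [hVc]; trivial
    obtain ⟨V, hV, h⟩ := hy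
    refine ⟨τ V, hτT V hV, ?_⟩
    simp only [mem_iUnion]
    exact ⟨V, hV, rfl, h⟩
  · intro y
    by_contra! h
    simp only [mem_iUnion] at h
    choose! v hv1 hv2 hv3 using h
    have h1 : v '' (T : Set ι) ⊆ {V ∈ 𝒱 | y ∈ V} := by
      rintro _ ⟨i, hi, rfl⟩
      exact ⟨hv1 i hi, hv3 i hi⟩
    have h2 := Set.ncard_le_ncard h1 (hVn y).1
    rw [Set.InjOn.ncard_image, Set.ncard_coe_finset] at h2
    · have := (hVn y).2
      omega
    · intro i hi j hj hij
      rw [← hv2 i hi, ← hv2 j hj, hij]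

/-- one step of the order reduction -/
theorem CovDimLENat.reduce {Y ι : Type*} [TopologicalSpace Y] {k : ℕ} (hY : CovDimLENat Y k)
    (T : Finset ι) (hT : k + 1 < T.card) (U : ι → Set Y) (hUo : ∀ i, IsOpen (U i))
    (hUc : ∀ y, ∃ i, y ∈ U i) :
    ∃ W : ι → Set Y, (∀ i, IsOpen (W i)) ∧ (∀ i, W i ⊆ U i) ∧ (∀ y, ∃ i, y ∈ W i) ∧
      (∀ y, ∃ i ∈ T, y ∉ W i) ∧ ∀ y i j, j ∈ T → y ∉ closure (U j) → y ∈ U i → y ∈ W i := by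
  classical
  obtain ⟨s0, hs0⟩ := Finset.card_pos.1 (by omega : 0 < T.card)
  let U' : ι → Set Y := fun i => if i = s0 then U s0 ∪ ⋃ j, ⋃ (_ : j ∉ T), U j else U i
  have hU's0 : U' s0 = U s0 ∪ ⋃ j, ⋃ (_ : j ∉ T), U j := if_pos rfl
  have hU'ne : ∀ i, i ≠ s0 → U' i = U i := fun i h => if_neg h
  have hsub : ∀ i, U i ⊆ U' i := by
    intro i
    by_cases h : i = s0
    · rw [h, hU's0]; exact subset_union_left
    · rw [hU'ne i h]
  obtain ⟨W, hWo, hWU, hWc, hWe⟩ := hY.shrink T hT U' (by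
      intro i
      by_cases h : i = s0
      · rw [h, hU's0]
        exact (hUo _).union (isOpen_iUnion fun j => isOpen_iUnion fun _ => hUo j)
      · rw [hU'ne i h]; exact hUo i) (by
      intro y
      obtain ⟨i, hi⟩ := hUc y
      by_cases h : i ∈ T
      · exact ⟨i, h, hsub i hi⟩
      · refine ⟨s0, hs0, ?_⟩
        rw [hU's0]
        right
        simp only [mem_iUnion]
        exact ⟨i, h, hi⟩)
  let B : Set Y := ⋂ j ∈ T, closure (U j)
  have hB : IsClosed B := isClosed_biInter fun j _ => isClosed_closure
  refine ⟨fun i => if i ∈ T then U i ∩ (W i ∪ Bᶜ) else U i, ?_, ?_, ?_, ?_, ?_⟩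
  · intro i
    dsimp only
    split_ifs
    · exact (hUo i).inter ((hWo i).union hB.isOpen_compl)
    · exact hUo i
  · intro i
    dsimp only
    split_ifs
    · exact inter_subset_left
    · exact subset_rfl
  · intro y
    obtain ⟨i, hi, hy⟩ := hWc y
    have hyU := hWU i hy
    by_cases h : y ∈ U i
    · exact ⟨i, by dsimp only; rw [if_pos hi]; exact ⟨h, Or.inl hy⟩⟩
    · have his : i = s0 := by
        by_contra h2
        rw [hU'ne i h2] at hyU
        exact h hyU
      subst his
      rw [hU's0] at hyU
      rcases hyU with h2 | h2
      · exact absurd h2 h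
      · simp only [mem_iUnion] at h2
        obtain ⟨j, hj, hyj⟩ := h2
        exact ⟨j, by dsimp only; rw [if_neg hj]; exact hyj⟩
  · intro y
    by_contra! h
    obtain ⟨i, hi, hyi⟩ := hWe y
    have hall : ∀ j ∈ T, y ∈ U j ∩ (W j ∪ Bᶜ) := fun j hj => by
      have := h j hj
      rwa [if_pos hj] at this
    have hyB : y ∈ B := mem_iInter₂.2 fun j hj => subset_closure (hall j hj).1
    rcases (hall i hi).2 with h3 | h3
    · exact hyi h3
    · exact h3 hyB
  · intro y i j hj hyj hyi
    dsimp only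
    split_ifs
    · exact ⟨hyi, Or.inr fun hyB => hyj (mem_iInter₂.1 hyB j hj)⟩
    · exact hyi

/-- Countable order reduction. -/
theorem CovDimLENat.countable {Y : Type*} [TopologicalSpace Y] {k : ℕ} (hY : CovDimLENat Y k)
    (U : ℕ → Set Y) (hUo : ∀ i, IsOpen (U i)) (hUc : ∀ y, ∃ i, y ∈ U i) (hlf : LocallyFinite U) :
    ∃ W : ℕ → Set Y, (∀ i, IsOpen (W i)) ∧ (∀ i, W i ⊆ U i) ∧ (∀ y, ∃ i, y ∈ W i) ∧
      ∀ T : Finset ℕ, k + 1 < T.card → ∀ y, ∃ i ∈ T, y ∉ W i := by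
  classical
  let Cov : (ℕ → Set Y) → Prop := fun U => (∀ i, IsOpen (U i)) ∧ ∀ y, ∃ i, y ∈ U i
  have step : ∀ (T : Finset ℕ) (U : ℕ → Set Y), Cov U → ∃ W : ℕ → Set Y, Cov W ∧
      (∀ i, W i ⊆ U i) ∧ (k + 1 < T.card → ∀ y, ∃ i ∈ T, y ∉ W i) ∧
      ∀ y i j, j ∈ T → y ∉ closure (U j) → y ∈ U i → y ∈ W i := by
    intro T U hU
    by_cases hT : k + 1 < T.card
    · obtain ⟨W, h1, h2, h3, h4, h5⟩ := hY.reduce T hT U hU.1 hU.2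
      exact ⟨W, ⟨h1, h3⟩, h2, fun _ => h4, h5⟩
    · exact ⟨U, hU, fun _ => subset_rfl, fun h => absurd h hT, fun _ _ _ _ _ h => h⟩
  choose! nxt hC hs he hl using step
  let en : ℕ → Finset ℕ := (Denumerable.eqv (Finset ℕ)).symm
  let seq : ℕ → ℕ → Set Y := fun n => Nat.rec U (fun n S => nxt (en n) S) n
  have hsucc : ∀ n, seq (n + 1) = nxt (en n) (seq n) := fun n => rfl
  have hcov : ∀ n, Cov (seq n) := by
    intro n
    induction n with
    | zero => exact ⟨hUo, hUc⟩
    | succ n ih => exact hC _ _ ih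
  have hanti : ∀ i, Antitone fun n => seq n i := fun i =>
    antitone_nat_of_succ_le fun n => hs _ _ (hcov n) i
  have hstab : ∀ y, ∃ O, IsOpen O ∧ y ∈ O ∧ ∃ N, ∀ y' ∈ O, ∀ i, y' ∈ seq N i →
      ∀ n, y' ∈ seq n i := by
    intro y
    obtain ⟨O', hO', hfin⟩ := hlf y
    obtain ⟨O, hOO', hO, hyO⟩ := mem_nhds_iff.1 hO'
    refine ⟨O, hO, hyO, (hfin.toFinset.powerset.image (Denumerable.eqv (Finset ℕ))).sup id + 1,
      fun y' hy' i hi n => ?_⟩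
    set N := (hfin.toFinset.powerset.image (Denumerable.eqv (Finset ℕ))).sup id + 1 with hN
    have hup : ∀ m, y' ∈ seq (N + m) i := by
      intro m
      induction m with
      | zero => exact hi
      | succ m ih =>
        have hnot : ¬ en (N + m) ⊆ hfin.toFinset := by
          intro hsub
          have : Denumerable.eqv (Finset ℕ) (en (N + m)) ≤
              (hfin.toFinset.powerset.image (Denumerable.eqv (Finset ℕ))).sup id :=
            Finset.le_sup (f := id)
              (Finset.mem_image.2 ⟨_, Finset.mem_powerset.2 hsub, rfl⟩)
          have h2 : Denumerable.eqv (Finset ℕ) (en (N + m)) = N + m := Equiv.apply_symm_apply _ _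
          omega
        obtain ⟨j, hj, hjf⟩ := Finset.not_subset.1 hnot
        refine hl (en (N + m)) (seq (N + m)) (hcov _) y' i j hj ?_ ih
        intro hcl
        obtain ⟨w, hw1, hw2⟩ := mem_closure_iff.1 hcl O hO hy'
        apply hjf
        rw [Set.Finite.mem_toFinset]
        exact ⟨w, hanti j (Nat.zero_le (N + m)) hw2, hOO' hw1⟩
    exact hanti i (Nat.le_add_left n N) (hup n)
  refine ⟨fun i => ⋂ n, seq n i, fun i => ?_, fun i => iInter_subset _ 0, fun y => ?_,
    fun T hT y => ?_⟩
  · rw [isOpen_iff_mem_nhds]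
    intro y hy
    obtain ⟨O, hO, hyO, N, hN⟩ := hstab y
    filter_upwards [hO.mem_nhds hyO, ((hcov N).1 i).mem_nhds (mem_iInter.1 hy N)] with y' h1 h2
    exact mem_iInter.2 (hN y' h1 i h2)
  · obtain ⟨O, hO, hyO, N, hN⟩ := hstab y
    obtain ⟨i, hi⟩ := (hcov N).2 y
    exact ⟨i, mem_iInter.2 (hN y hyO i hi)⟩
  · have hTn : en (Denumerable.eqv (Finset ℕ) T) = T := Equiv.symm_apply_apply _ _
    obtain ⟨i, hi, h⟩ := he T (seq (Denumerable.eqv (Finset ℕ) T)) (hcov _) hT y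
    refine ⟨i, hi, fun hy => h ?_⟩
    have := mem_iInter.1 hy (Denumerable.eqv (Finset ℕ) T + 1)
    rw [hsucc, hTn] at this
    exact this

theorem sel_of_dim {Y : Type*} [TopologicalSpace Y] [NormalSpace Y] [ParacompactSpace Y]
    [T2Space Y] {k m : ℕ} (hkm : k ≤ m) (hY : CovDimLENat Y k)
    (U : ℕ → Y → Set Y) (hUo : ∀ n z, IsOpen (U n z)) (hUc : ∀ n, n ≤ m → ⋃ z, U n z = univ) :
    ∃ V : ℕ → Y → Set Y, (∀ n z, IsOpen (V n z)) ∧ (∀ n z, V n z ⊆ U n z) ∧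
        (∀ n z z', z ≠ z' → Disjoint (V n z) (V n z')) ∧ ∀ y, ∃ n z, y ∈ V n z := by
  classical
  -- common refinement
  obtain ⟨A, hAo, hAU, hAd, hAc⟩ := barycentric
    (fun c : Fin (k + 1) → Y => ⋂ i : Fin (k + 1), U i (c i))
    (fun c => isOpen_iInter_of_finite fun i => hUo i (c i))
    (by
      refine iUnion_eq_univ_iff.2 fun y => ?_
      have : ∀ i : Fin (k + 1), ∃ z, y ∈ U i z := fun i =>
        iUnion_eq_univ_iff.1 (hUc i (by omega)) y
      choose c hc using this
      exact ⟨c, mem_iInter.2 hc⟩)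
  -- countable cover
  obtain ⟨O', hO'o, hO'c, hO'lf, hO's⟩ := precise_refinement
    (fun n : ℕ => ⋃ S, ⋃ (_ : S.card = n ∧ S.Nonempty), A S)
    (fun n => isOpen_iUnion fun S => isOpen_iUnion fun _ => hAo S)
    (by
      refine iUnion_eq_univ_iff.2 fun y => ?_
      obtain ⟨S, hS, hy⟩ := hAc y
      refine ⟨S.card, ?_⟩
      simp only [mem_iUnion]
      exact ⟨S, ⟨rfl, hS⟩, hy⟩)
  obtain ⟨W, hWo, hWs, hWc, hWT⟩ := hY.countable O' hO'o (iUnion_eq_univ_iff.1 hO'c) hO'lf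
  obtain ⟨B, hBo, hBW, hBd, hBc⟩ := barycentric W hWo (iUnion_eq_univ_iff.2 hWc)
  let J : ℕ → Type _ := fun n => {q : Finset ℕ × Finset (Fin (k + 1) → Y) //
    q.1.card = n + 1 ∧ n ≤ k ∧ q.2.Nonempty ∧ q.2.card = q.1.sup id ∧ q.1.Nonempty}
  have : ∀ n, ∃ V : Y → Set Y, (∀ z, IsOpen (V z)) ∧ (∀ z, V z ⊆ U n z) ∧
      (∀ z z', z ≠ z' → Disjoint (V z) (V z')) ∧
      ∀ q : J n, ∀ y ∈ B q.1.1 ∩ A q.1.2, ∃ z, y ∈ V z := by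
    intro n
    refine pieces_to_index (fun q : J n => B q.1.1 ∩ A q.1.2)
      (fun q => (hBo _).inter (hAo _)) ?_ (U n) ?_
    · rintro ⟨⟨Q, S⟩, h1, h2, h3, h4, h5⟩ ⟨⟨Q', S'⟩, h1', h2', h3', h4', h5'⟩ hne
      dsimp only at *
      by_cases hQ : Q = Q'
      · subst hQ
        have hS : S ≠ S' := by rintro rfl; exact hne rfl
        exact (hAd S S' hS (by rw [h4, h4'])).mono inter_subset_right inter_subset_right
      · exact (hBd Q Q' hQ (by rw [h1, h1'])).mono inter_subset_left inter_subset_left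
    · rintro ⟨⟨Q, S⟩, h1, h2, ⟨c, hc⟩, h4, h5⟩
      refine ⟨c ⟨n, by omega⟩, fun y hy => ?_⟩
      exact mem_iInter.1 (hAU S c hc hy.2) ⟨n, by omega⟩
  choose V h1 h2 h3 h4 using this
  refine ⟨V, h1, h2, h3, fun y => ?_⟩
  obtain ⟨Q, hQ, hyQ⟩ := hBc y
  have hcard : Q.card ≤ k + 1 := by
    by_contra! h
    obtain ⟨i, hi, hy⟩ := hWT Q h y
    exact hy (hBW Q i hi hyQ)
  have hsup : Q.sup id ∈ Q := by
    obtain ⟨i, hi, h⟩ := Finset.exists_mem_eq_sup Q hQ id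
    rw [h]; exact hi
  have hyO := hO's _ (hWs _ (hBW Q _ hsup hyQ))
  simp only [mem_iUnion] at hyO
  obtain ⟨S, ⟨hS1, hS2⟩, hyS⟩ := hyO
  have hpos := Finset.card_pos.2 hQ
  obtain ⟨z, hz⟩ := h4 (Q.card - 1) ⟨(Q, S), by dsimp only; omega, by omega, hS2, hS1, hQ⟩ y
    ⟨hyQ, hyS⟩
  exact ⟨_, z, hz⟩

/-! ### Convex combinations of bounded maps -/

section Conv

variable {X E : Type*} [TopologicalSpace X] [NormedAddCommGroup E] [NormedSpace ℝ E]
  {K : Set E} (hK : Convex ℝ K)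

/-- pointwise convex combination -/
noncomputable def cmb (τ : unitInterval) (a b : K) : K :=
  ⟨(1 - (τ : ℝ)) • (a : E) + (τ : ℝ) • (b : E),
    hK a.2 b.2 (by linarith [τ.2.2]) τ.2.1 (by ring)⟩

theorem cmb_dist (τ τ' : unitInterval) (a b a' b' : K) :
    dist (cmb hK τ a b) (cmb hK τ' a' b') ≤
      dist a a' + dist b b' + |(τ : ℝ) - τ'| * dist a' b' := by
  simp only [Subtype.dist_eq, cmb, dist_eq_norm]
  have h : (1 - (τ : ℝ)) • (a : E) + (τ : ℝ) • (b : E) -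
      ((1 - (τ' : ℝ)) • (a' : E) + (τ' : ℝ) • (b' : E)) =
      (1 - (τ : ℝ)) • ((a : E) - a') + (τ : ℝ) • ((b : E) - b') -
        ((τ : ℝ) - τ') • ((a' : E) - b') := by
    module
  rw [h]
  have h0 := τ.2.1
  have h1 := τ.2.2
  refine (norm_sub_le _ _).trans (add_le_add ((norm_add_le _ _).trans (add_le_add ?_ ?_)) ?_)
  · rw [norm_smul, Real.norm_of_nonneg (by linarith)]
    exact mul_le_of_le_one_left (norm_nonneg _) (by linarith)
  · rw [norm_smul, Real.norm_of_nonneg h0]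
    exact mul_le_of_le_one_left (norm_nonneg _) h1
  · rw [norm_smul, Real.norm_eq_abs]

theorem cmb_dist_left (τ : unitInterval) (a b : K) : dist (cmb hK τ a b) a ≤ dist b a := by
  simp only [Subtype.dist_eq, cmb, dist_eq_norm]
  have h : (1 - (τ : ℝ)) • (a : E) + (τ : ℝ) • (b : E) - a = (τ : ℝ) • ((b : E) - a) := by
    module
  rw [h, norm_smul, Real.norm_of_nonneg τ.2.1]
  exact mul_le_of_le_one_left (norm_nonneg _) τ.2.2

theorem cmb_dist_ball (τ : unitInterval) (a b c : K) (r : ℝ) (ha : dist a c ≤ r)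
    (hb : dist b c ≤ r) : dist (cmb hK τ a b) c ≤ r := by
  simp only [Subtype.dist_eq] at *
  exact (convex_closedBall (c : E) r) ha hb (by linarith [τ.2.2]) τ.2.1 (by ring)

/-- convex combination of bounded continuous maps -/
noncomputable def bmix (τ : unitInterval) (g h : X →ᵇ K) : X →ᵇ K where
  toFun x := cmb hK τ (g x) (h x)
  continuous_toFun := by
    refine Continuous.subtype_mk ?_ _
    have h1 : Continuous fun x => ((g x : K) : E) := continuous_subtype_val.comp g.continuous
    have h2 : Continuous fun x => ((h x : K) : E) := continuous_subtype_val.comp h.continuous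
    fun_prop
  map_bounded' := by
    obtain ⟨C, hC⟩ := g.bounded
    obtain ⟨C', hC'⟩ := h.bounded
    refine ⟨C + C', fun x y => (cmb_dist hK τ τ _ _ _ _).trans ?_⟩
    have := hC x y
    have := hC' x y
    simp only [sub_self, abs_zero, zero_mul, add_zero]
    linarith

theorem bmix_apply (τ : unitInterval) (g h : X →ᵇ K) (x : X) :
    bmix hK τ g h x = cmb hK τ (g x) (h x) := rfl

theorem bmix_dist (τ τ' : unitInterval) (a b a' b' : X →ᵇ K) :
    dist (bmix hK τ a b) (bmix hK τ' a' b') ≤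
      dist a a' + dist b b' + |(τ : ℝ) - τ'| * dist a' b' := by
  rw [BoundedContinuousFunction.dist_le (by positivity)]
  intro x
  refine (cmb_dist hK τ τ' _ _ _ _).trans ?_
  gcongr <;> exact BoundedContinuousFunction.dist_coe_le_dist x

theorem bmix_cont : Continuous fun p : unitInterval × (X →ᵇ K) × (X →ᵇ K) =>
    bmix hK p.1 p.2.1 p.2.2 := by
  refine continuous_iff_continuousAt.2 fun q => ?_
  rw [ContinuousAt, tendsto_iff_dist_tendsto_zero]
  have h : Continuous fun p : unitInterval × (X →ᵇ K) × (X →ᵇ K) =>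
      dist p.2.1 q.2.1 + dist p.2.2 q.2.2 + |(p.1 : ℝ) - q.1| * dist q.2.1 q.2.2 := by
    fun_prop
  have h2 := h.tendsto q
  simp only [dist_self, sub_self, abs_zero, zero_mul, add_zero] at h2
  exact squeeze_zero (fun _ => dist_nonneg) (fun p => bmix_dist hK _ _ _ _ _ _) h2

/-- the mixing structure on a closed ball of the source limitation topology -/
noncomputable def ballMix (α : X → ℝ) (g : X →ᵇ K) :
    MixStr ↥{h : X →ᵇ ↥K | ∀ x, dist (h x) (g x) ≤ α x} where
  mix τ a b := ⟨bmix hK τ a.1 b.1, fun x => cmb_dist_ball hK τ _ _ _ _ (a.2 x) (b.2 x)⟩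
  cont := by
    refine Continuous.subtype_mk ?_ _
    exact (bmix_cont hK).comp (continuous_fst.prodMk
      ((continuous_subtype_val.comp (continuous_fst.comp continuous_snd)).prodMk
        (continuous_subtype_val.comp (continuous_snd.comp continuous_snd))))
  zero a b := by
    refine Subtype.ext ?_
    ext x
    simp [bmix_apply, cmb]
  one a b := by
    refine Subtype.ext ?_
    ext x
    simp [bmix_apply, cmb]
  dist_le τ a b := by
    simp only [Subtype.dist_eq]
    rw [BoundedContinuousFunction.dist_le dist_nonneg]
    intro x
    exact (cmb_dist_left hK τ _ _).trans (BoundedContinuousFunction.dist_coe_le_dist x)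

end Conv

theorem dense_core {X Y E : Type*} [TopologicalSpace X]
    [TopologicalSpace Y] [TopologicalSpace.MetrizableSpace Y] [Nonempty Y]
    [NormedAddCommGroup E] [NormedSpace ℝ E]
    (K : Set E) (hKcv : Convex ℝ K)
    (f : X → Y) (hf : Continuous f)
    (𝒞 : Y → Set (X →ᵇ ↥K))
    (hdet : ∀ y : Y, ∀ g ∈ 𝒞 y, ∀ h : X →ᵇ ↥K,
      (∀ x ∈ f ⁻¹' {y}, h x = g x) → h ∈ 𝒞 y)
    (hgraph : IsClosed {q : Y × (X →ᵇ ↥K) | q.2 ∉ 𝒞 q.1})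
    (D : ℕ → Prop)
    (hsel : ∀ U : ℕ → Y → Set Y, (∀ n z, IsOpen (U n z)) → (∀ n, D n → ⋃ z, U n z = univ) →
      ∃ V : ℕ → Y → Set Y, (∀ n z, IsOpen (V n z)) ∧ (∀ n z, V n z ⊆ U n z) ∧
        (∀ n z z', z ≠ z' → Disjoint (V n z) (V n z')) ∧ ∀ y, ∃ n z, y ∈ V n z)
    (hZ : ∀ (α : X → ℝ), Continuous α → (∀ x, 0 < α x) → ∀ (y : Y) (g : X →ᵇ ↥K),
      ∀ n, D n → ApprAvoid n (Subtype.val ⁻¹' (𝒞 y)ᶜ :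
          Set ↥{h : X →ᵇ ↥K | ∀ x, dist (h x) (g x) ≤ α x})) :
    @Dense _ (sourceLimitation X ↥K) (⋂ y, 𝒞 y) := by
  letI := TopologicalSpace.metrizableSpaceMetric Y
  rw [@dense_iff_inter_open _ (sourceLimitation X ↥K)]
  rintro W hW ⟨g, hgW⟩
  obtain ⟨α, hαc, hα0, hα⟩ := hW g hgW
  let β : X → ℝ := fun x => min (α x) 1
  have hβc : Continuous β := hαc.min continuous_const
  have hβ0 : ∀ x, 0 < β x := fun x => lt_min (hα0 x) one_pos
  let M := ↥{h : X →ᵇ ↥K | ∀ x, dist (h x) (g x) ≤ β x}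
  haveI : Nonempty M := ⟨⟨g, fun x => by rw [dist_self]; exact (hβ0 x).le⟩⟩
  let ψ : Y → Set M := fun y => Subtype.val ⁻¹' (𝒞 y)ᶜ
  have hgr : IsClosed {q : Y × M | q.2 ∈ ψ q.1} :=
    hgraph.preimage (continuous_fst.prodMk (continuous_subtype_val.comp continuous_snd))
  have hcl : ∀ y, IsClosed (ψ y) := fun y =>
    hgr.preimage (continuous_const.prodMk continuous_id : Continuous fun x : M => (y, x))
  obtain ⟨s, hsc, hs⟩ := exists_selection (ballMix hKcv β g) hgr hcl D
    (fun n hn y => hZ β hβc hβ0 y g n hn) hsel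
  obtain ⟨C, hC⟩ := g.bounded
  have hball : ∀ x, dist ((s (f x)).1 x) (g x) ≤ β x := fun x => (s (f x)).2 x
  let h : X →ᵇ K :=
    { toFun := fun x => (s (f x)).1 x
      continuous_toFun := by
        have h1 : Continuous fun x => ((s (f x)).1, x) :=
          (continuous_subtype_val.comp (hsc.comp hf)).prodMk continuous_id
        exact (continuous_eval (F := X →ᵇ K)).comp h1
      map_bounded' := by
        refine ⟨1 + C + 1, fun x y => ?_⟩
        have h1 := (hball x).trans (min_le_right _ _)
        have h2 := (hball y).trans (min_le_right _ _)
        rw [dist_comm] at h2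
        have h3 := dist_triangle4 ((s (f x)).1 x) (g x) (g y) ((s (f y)).1 y)
        have h4 := hC x y
        linarith }
  refine ⟨h, hα h fun x => (hball x).trans (min_le_left _ _), mem_iInter.2 fun y => ?_⟩
  have hy : (s y).1 ∈ 𝒞 y := by
    by_contra hh
    exact hs y hh
  refine hdet y _ hy h fun x hx => ?_
  have : f x = y := hx
  change (s (f x)).1 x = _
  rw [this]

/-- (Lemma 2.3) If `Y` is a C-space (resp. `dim Y ≤ m`), the map
`ψ(y) = 𝒞(y)ᶜ` has a closed graph, and each `ψ(y) ∩ B̄(g,α)` is a `Z`-set (resp. a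
`Z_m`-set) in `B̄(g,α)`, then `𝒞(Y) = ⋂ y, 𝒞 y` is dense in `C*(X,K)` with respect to the
source limitation topology. -/
theorem statement5 {X Y E : Type*} [TopologicalSpace X] [TopologicalSpace.MetrizableSpace X]
    [TopologicalSpace Y] [TopologicalSpace.MetrizableSpace Y]
    [NormedAddCommGroup E] [NormedSpace ℝ E] [CompleteSpace E]
    (K : Set E) (hKcl : IsClosed K) (hKcv : Convex ℝ K)
    (f : X → Y) (hf : IsPerfectMap f) (hfsurj : Function.Surjective f)
    (𝒞 : Y → Set (X →ᵇ ↥K))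
    (hdet : ∀ y : Y, ∀ g ∈ 𝒞 y, ∀ h : X →ᵇ ↥K,
      (∀ x ∈ f ⁻¹' {y}, h x = g x) → h ∈ 𝒞 y)
    (hgraph : IsClosed {q : Y × (X →ᵇ ↥K) | q.2 ∉ 𝒞 q.1}) :
    (IsCSpace Y →
      (∀ (α : X → ℝ), Continuous α → (∀ x, 0 < α x) → ∀ (y : Y) (g : X →ᵇ ↥K),
        IsZSet (Subtype.val ⁻¹' (𝒞 y)ᶜ :
          Set ↥{h : X →ᵇ ↥K | ∀ x, dist (h x) (g x) ≤ α x})) →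
      @Dense _ (sourceLimitation X ↥K) (⋂ y, 𝒞 y)) ∧
    (∀ m : ℕ, CovDimLE Y m →
      (∀ (α : X → ℝ), Continuous α → (∀ x, 0 < α x) → ∀ (y : Y) (g : X →ᵇ ↥K),
        IsZmSet m (Subtype.val ⁻¹' (𝒞 y)ᶜ :
          Set ↥{h : X →ᵇ ↥K | ∀ x, dist (h x) (g x) ≤ α x})) →
      @Dense _ (sourceLimitation X ↥K) (⋂ y, 𝒞 y)) := by
  classical
  rcases isEmpty_or_nonempty Y with hY | hY
  · have h : (⋂ y, 𝒞 y) = univ := by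
      ext g; simp
    rw [h]
    exact ⟨fun _ _ => @dense_univ _ (sourceLimitation X ↥K),
      fun _ _ _ => @dense_univ _ (sourceLimitation X ↥K)⟩
  letI := TopologicalSpace.metrizableSpaceMetric Y
  refine ⟨fun hC hZ => ?_, fun m hd hZ => ?_⟩
  · refine dense_core K hKcv f hf.1 𝒞 hdet hgraph (fun _ => True)
      (fun U hU hUc => sel_of_CSpace hC U hU fun n => hUc n trivial) ?_
    intro α hα hα0 y g n _
    exact (hZ α hα hα0 y g n).appr
  · rcases hd with hE | ⟨k, hk, hd⟩
    · exact absurd hY (not_nonempty_iff.2 hE)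
    · refine dense_core K hKcv f hf.1 𝒞 hdet hgraph (fun n => n ≤ m)
        (fun U hU hUc => sel_of_dim (by exact_mod_cast hk) hd U hU hUc) ?_
      intro α hα hα0 y g n hn
      exact (hZ α hα hα0 y g).appr.mono hn
end

section
/- Let f : X → Y be a perfect 0-dimensional map between metrizable spaces with dim Y ≤ m. Then C*(X) = C*(X, ℝ), endowed with the source limitation topology, contains a dense G_δ-subset of maps g such that each fiber of f×g : X → Y × ℝ contains at most m + 1 points. -/
open Set Topology Metric BoundedContinuousFunction

/-- A countable algebraically independent family of reals with prescribed approximations. -/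
theorem exists_generic : ∃ b : ℕ × ℕ × ℕ → ℝ, AlgebraicIndependent ℚ b ∧
    ∀ n p : ℕ, ∀ c ε : ℝ, 0 < ε → ∃ j, |b (n, p, j) - c| < ε := by
  obtain ⟨s, hs⟩ := exists_isTranscendenceBasis ℚ ℝ
  have hinf : Infinite s := by
    by_contra hfin
    rw [not_infinite_iff_finite] at hfin
    have : Countable ℝ := by
      have h1 : Countable (Algebra.adjoin ℚ (Set.range ((↑) : s → ℝ))) := by
        have e := hs.1.aevalEquiv
        have : Countable (MvPolynomial s ℚ) := by
          rw [← Cardinal.mk_le_aleph0_iff]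
          refine MvPolynomial.cardinalMk_le_max.trans ?_
          simp
        exact e.symm.toEquiv.injective.countable
      have h2 := hs.isAlgebraic
      have h3 := Algebra.IsAlgebraic.cardinalMk_le_max
        (Algebra.adjoin ℚ (Set.range ((↑) : s → ℝ))) ℝ
      rw [← Cardinal.mk_le_aleph0_iff]
      exact h3.trans (max_le (Cardinal.mk_le_aleph0_iff.2 h1) le_rfl)
    exact Cardinal.not_countable_real (Set.countable_univ_iff.2 this)
  let e : ℕ × ℕ × ℕ → s := fun x => Infinite.natEmbedding s (Encodable.encode x)
  have he : Function.Injective e :=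
    (Infinite.natEmbedding s).injective.comp Encodable.encode_injective
  have hb0 : AlgebraicIndependent ℚ (fun i => ((e i : s) : ℝ)) := hs.1.comp e he
  -- target approximations
  obtain ⟨t, htsurj⟩ := exists_surjective_nat (ℚ × ℕ)
  have hq : ∀ i : ℕ × ℕ × ℕ, ∃ q : ℚ,
      |((e i : s) : ℝ) + q - (t i.2.2).1| < 1 / ((t i.2.2).2 + 1 : ℝ) := by
    intro i
    obtain ⟨q, hq1, hq2⟩ := exists_rat_btwn
      (show ((t i.2.2).1 : ℝ) - (e i : s) - 1 / ((t i.2.2).2 + 1 : ℝ) <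
        ((t i.2.2).1 : ℝ) - (e i : s) + 1 / ((t i.2.2).2 + 1 : ℝ) by
          have : 0 < 1 / ((t i.2.2).2 + 1 : ℝ) := by positivity
          linarith)
    refine ⟨q, ?_⟩
    rw [abs_lt]
    constructor <;> linarith
  choose q hq using hq
  refine ⟨fun i => (e i : s) + q i, ?_, ?_⟩
  · have := hb0.polynomial_aeval_of_transcendental
      (f := fun i => Polynomial.X + Polynomial.C (q i)) (fun i => by
        apply Polynomial.transcendental
        · simp
        · simp)
    simpa using this
  · intro n p c ε hε
    obtain ⟨r, hr⟩ := exists_nat_one_div_lt (half_pos hε)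
    obtain ⟨a, ha1, ha2⟩ := exists_rat_btwn (show c - ε / 2 < c + ε / 2 by linarith)
    obtain ⟨j, ht⟩ := htsurj (a, r)
    refine ⟨j, ?_⟩
    have h := hq (n, p, j)
    simp only [ht] at h
    rw [abs_lt] at h ⊢
    constructor <;> linarith

/-- Generic linear systems have no nontrivial affine solutions. -/
theorem generic_ne {A : Type*} [Fintype A] [DecidableEq A]
    (b : Option A × A → ℝ) (hb : AlgebraicIndependent ℚ b) (t : A → ℝ) (c : ℝ)
    (ht : ∑ i, t i = 1) (h : ∀ a : Option A, ∑ i, t i * b (a, i) = c) : False := by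
  let P : Matrix (Option A) (Option A) (MvPolynomial (Option A × A) ℚ) :=
    Matrix.of fun a i => i.elim 1 (fun j => MvPolynomial.X (a, j))
  have hP : P.det = 0 := by
    apply hb
    rw [map_zero, AlgHom.map_det]
    apply Matrix.exists_mulVec_eq_zero_iff.1
    refine ⟨fun i => i.elim (-c) t, ?_, ?_⟩
    · intro h0
      have : ∀ i, t i = 0 := fun i => congrFun h0 (some i)
      simp [this] at ht
    · funext a
      have := h a
      simp only [Matrix.mulVec, dotProduct, Fintype.sum_option]
      simp [P, mul_comm] at this ⊢
      linarith
  have h2 : ((MvPolynomial.aeval (R := ℚ)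
      (fun p : Option A × A => if p.1 = some p.2 then (1 : ℚ) else 0)).mapMatrix P).det = 0 := by
    rw [← AlgHom.map_det, hP, map_zero]
  obtain ⟨v, hv0, hv⟩ := Matrix.exists_mulVec_eq_zero_iff.2 h2
  apply hv0
  have hn := congrFun hv none
  simp [Matrix.mulVec, dotProduct, Fintype.sum_option, P] at hn
  funext i
  cases i with
  | none => exact hn
  | some j =>
    have hj := congrFun hv (some j)
    simp [Matrix.mulVec, dotProduct, Fintype.sum_option, P, hn] at hj
    exact hj

/-- One step: kill a given `k+2`-fold intersection. -/
theorem kill_one {Y : Type*} [TopologicalSpace Y] {k : ℕ} (hY : CovDimLENat Y k)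
    (U : ℕ → Set Y) (hU : ∀ n, IsOpen (U n)) (hc : ∀ y, ∃ n, y ∈ U n)
    (T : Finset ℕ) :
    ∃ V : ℕ → Set Y, (∀ n, IsOpen (V n)) ∧ (∀ y, ∃ n, y ∈ V n) ∧ (∀ n, V n ⊆ U n) ∧
      (T.card = k + 2 → ∀ y, ∃ n ∈ T, y ∉ V n) ∧
      (∀ N : Set Y, IsOpen N → (∃ l ∈ T, Disjoint N (U l)) → ∀ n, N ∩ U n ⊆ V n) := by
  classical
  let W : Set Y := ⋃ n ∈ (T : Set ℕ)ᶜ, U n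
  let 𝒰 : Set (Set Y) := insert W (U '' (T : Set ℕ))
  obtain ⟨𝒱, hVo, hVc, hVU, hVord⟩ := hY 𝒰 ((T.finite_toSet.image U).insert W) (by
      rintro _ (rfl | ⟨n, -, rfl⟩)
      · exact isOpen_biUnion fun n _ => hU n
      · exact hU n) (by
      refine eq_univ_of_forall fun y => ?_
      obtain ⟨n, hn⟩ := hc y
      by_cases hnT : n ∈ T
      · exact ⟨U n, Or.inr ⟨n, hnT, rfl⟩, hn⟩
      · exact ⟨W, Or.inl rfl, mem_biUnion (by simpa using hnT) hn⟩)
  have hidx : ∀ V ∈ 𝒱, ∃ o : Option ℕ, (o = none ∧ V ⊆ W) ∨ ∃ n ∈ T, o = some n ∧ V ⊆ U n := by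
    intro V hV
    obtain ⟨_, (rfl | ⟨n, hn, rfl⟩), h⟩ := hVU V hV
    · exact ⟨none, Or.inl ⟨rfl, h⟩⟩
    · exact ⟨some n, Or.inr ⟨n, hn, rfl, h⟩⟩
  choose! o ho using hidx
  let Z : ℕ → Set Y := fun n => ⋃₀ {V ∈ 𝒱 | o V = some n}
  have hZo : ∀ n, IsOpen (Z n) := fun n => isOpen_sUnion fun V hV => hVo V hV.1
  have hZU : ∀ n, Z n ⊆ U n := by
    rintro n y ⟨V, ⟨hV, hoV⟩, hy⟩
    rcases ho V hV with ⟨h1, _⟩ | ⟨n', _, h1, h2⟩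
    · simp [hoV] at h1
    · rw [hoV] at h1
      cases h1
      exact h2 hy
  let C : Set Y := ⋂ l ∈ T, closure (U l)
  have hCc : IsClosed C := isClosed_biInter fun l _ => isClosed_closure
  refine ⟨fun n => if n ∈ T then Z n ∪ (U n \ C) else U n, ?_, ?_, ?_, ?_, ?_⟩
  · intro n
    dsimp only
    split_ifs
    · exact (hZo n).union ((hU n).sdiff hCc)
    · exact hU n
  · intro y
    have : y ∈ ⋃₀ 𝒱 := by rw [hVc]; trivial
    obtain ⟨V, hV, hy⟩ := this
    rcases ho V hV with ⟨h1, h2⟩ | ⟨n, hn, h1, h2⟩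
    · obtain ⟨n, hn, hyn⟩ := mem_iUnion₂.1 (h2 hy)
      refine ⟨n, ?_⟩
      dsimp only
      rw [if_neg (by simpa using hn)]
      exact hyn
    · refine ⟨n, ?_⟩
      dsimp only
      rw [if_pos hn]
      exact Or.inl ⟨V, ⟨hV, h1⟩, hy⟩
  · intro n
    dsimp only
    split_ifs
    · exact union_subset (hZU n) sdiff_subset
    · exact subset_rfl
  · intro hT y
    by_contra! hcon
    have hyU : ∀ n ∈ T, y ∈ U n := by
      intro n hn
      have := hcon n hn
      rw [if_pos hn] at this
      rcases this with h | h
      · exact hZU n h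
      · exact h.1
    have hyC : y ∈ C := mem_iInter₂.2 fun l hl => subset_closure (hyU l hl)
    have hyZ : ∀ n ∈ T, ∃ V, V ∈ 𝒱 ∧ o V = some n ∧ y ∈ V := by
      intro n hn
      have := hcon n hn
      rw [if_pos hn] at this
      rcases this with ⟨V, ⟨h1, h2⟩, h3⟩ | h
      · exact ⟨V, h1, h2, h3⟩
      · exact absurd hyC h.2
    choose! v hv1 hv2 hv3 using hyZ
    have hinj : Set.InjOn v (T : Set ℕ) := by
      intro a ha b hb hab
      have h1 := hv2 a ha
      have h2 := hv2 b hb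
      rw [hab, h2] at h1
      exact (Option.some.inj h1).symm
    have h1 : (v '' (T : Set ℕ)).ncard = k + 2 := by
      rw [hinj.ncard_image, Set.ncard_coe_finset, hT]
    have h2 : v '' (T : Set ℕ) ⊆ {V ∈ 𝒱 | y ∈ V} := by
      rintro _ ⟨n, hn, rfl⟩
      exact ⟨hv1 n hn, hv3 n hn⟩
    have h3 := Set.ncard_le_ncard h2 (hVord y).1
    have h4 := (hVord y).2
    omega
  · rintro N hN ⟨l, hl, hd⟩ n y ⟨hyN, hyU⟩
    dsimp only
    split_ifs
    · refine Or.inr ⟨hyU, fun hyC => ?_⟩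
      have := mem_iInter₂.1 hyC l hl
      exact disjoint_left.1 (hd.closure_right hN) hyN this
    · exact hyU

/-- Countable locally finite covers can be shrunk to order `≤ k + 1`. -/
theorem shrink_order {Y : Type*} [TopologicalSpace Y] {k : ℕ} (hY : CovDimLENat Y k)
    (U : ℕ → Set Y) (hU : ∀ n, IsOpen (U n)) (hc : ∀ y, ∃ n, y ∈ U n) (hlf : LocallyFinite U) :
    ∃ V : ℕ → Set Y, (∀ n, IsOpen (V n)) ∧ (∀ y, ∃ n, y ∈ V n) ∧ (∀ n, V n ⊆ U n) ∧
      ∀ T : Finset ℕ, T.card = k + 2 → ∀ y, ∃ n ∈ T, y ∉ V n := by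
  classical
  let St := {V : ℕ → Set Y // (∀ n, IsOpen (V n)) ∧ (∀ y, ∃ n, y ∈ V n)}
  choose F hFo hFc hFs hFk hFl using fun (T : Finset ℕ) (V : St) =>
    kill_one hY V.1 V.2.1 V.2.2 T
  obtain ⟨tt⟩ : Nonempty (ℕ ≃ Finset ℕ) := ⟨(Denumerable.eqv (Finset ℕ)).symm⟩
  let seq : ℕ → St := fun j => Nat.rec ⟨U, hU, hc⟩
    (fun j V => ⟨F (tt j) V, hFo (tt j) V, hFc (tt j) V⟩) j
  have hs0 : (seq 0).1 = U := rfl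
  have hss : ∀ j, (seq (j + 1)).1 = F (tt j) (seq j) := fun j => rfl
  have hmono : ∀ n, Antitone fun j => (seq j).1 n := by
    intro n
    refine antitone_nat_of_succ_le fun j => ?_
    rw [hss]
    exact hFs _ _ _
  have hsU : ∀ j n, (seq j).1 n ⊆ U n := fun j n => hmono n (Nat.zero_le j)
  have hloc : ∀ y, ∃ N, IsOpen N ∧ y ∈ N ∧ ∃ J, ∀ n j, J ≤ j →
      N ∩ (seq J).1 n ⊆ (seq j).1 n := by
    intro y
    obtain ⟨M, hM, hfin⟩ := hlf y
    obtain ⟨N, hNM, hNo, hyN⟩ := mem_nhds_iff.1 hM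
    refine ⟨N, hNo, hyN, ?_⟩
    have hfin2 : {j | ((tt j : Finset ℕ) : Set ℕ) ⊆ {i | (U i ∩ M).Nonempty}}.Finite := by
      have : {T : Finset ℕ | (T : Set ℕ) ⊆ {i | (U i ∩ M).Nonempty}}.Finite := by
        have h := (hfin.toFinset.powerset).finite_toSet
        refine h.subset fun T hT => ?_
        simp only [Finset.coe_powerset, mem_preimage, mem_powerset_iff]
        simpa using hT
      refine this.preimage (f := tt) ?_
      intro a _ b _ hab
      exact tt.injective hab
    obtain ⟨J, hJ⟩ := hfin2.bddAbove
    refine ⟨J + 1, fun n j hj => ?_⟩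
    induction j, hj using Nat.le_induction with
    | base => exact inter_subset_right
    | succ j hj ih =>
      intro z hz
      rw [hss]
      refine hFl (tt j) (seq j) N hNo ?_ n ⟨hz.1, ih hz⟩
      have hnot : ¬ ((tt j : Finset ℕ) : Set ℕ) ⊆ {i | (U i ∩ M).Nonempty} := by
        intro h
        have := hJ h
        omega
      obtain ⟨l, hl, hl2⟩ := not_subset.1 hnot
      refine ⟨l, hl, ?_⟩
      rw [Set.disjoint_left]
      intro w hw hw2
      exact hl2 ⟨w, hsU _ _ hw2, hNM hw⟩
  refine ⟨fun n => ⋂ j, (seq j).1 n, ?_, ?_, ?_, ?_⟩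
  · intro n
    rw [isOpen_iff_mem_nhds]
    intro y hy
    obtain ⟨N, hNo, hyN, J, hJ⟩ := hloc y
    have : N ∩ (seq J).1 n ∈ 𝓝 y :=
      (hNo.inter ((seq J).2.1 n)).mem_nhds ⟨hyN, mem_iInter.1 hy J⟩
    filter_upwards [this] with z hz
    refine mem_iInter.2 fun j => ?_
    rcases le_total J j with h | h
    · exact hJ n j h hz
    · exact hmono n h hz.2
  · intro y
    obtain ⟨N, hNo, hyN, J, hJ⟩ := hloc y
    obtain ⟨n, hn⟩ := (seq J).2.2 y
    refine ⟨n, mem_iInter.2 fun j => ?_⟩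
    rcases le_total J j with h | h
    · exact hJ n j h ⟨hyN, hn⟩
    · exact hmono n h hn
  · intro n
    exact iInter_subset (fun j => (seq j).1 n) 0
  · intro T hT y
    have htt : tt (tt.symm T) = T := tt.apply_symm_apply T
    obtain ⟨n, hn, hyn⟩ := hFk (tt (tt.symm T)) (seq (tt.symm T))
      (by rw [htt]; exact hT) y
    refine ⟨n, by rwa [htt] at hn, fun h => hyn ?_⟩
    exact mem_iInter.1 h (tt.symm T + 1)

/-- σ-disjoint open refinement in metric spaces. -/
theorem sigma_disjoint {Y : Type*} [MetricSpace Y] (O : Y → Set Y) (hO : ∀ y, IsOpen (O y))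
    (hy : ∀ y, y ∈ O y) :
    ∃ U : ℕ → Y → Set Y, (∀ n i, IsOpen (U n i)) ∧ (∀ n i, U n i ⊆ O i) ∧
      (∀ n i i' z, z ∈ U n i → z ∈ U n i' → i = i') ∧ ∀ y, ∃ n i, y ∈ U n i := by
  classical
  have wf : WellFounded (WellOrderingRel : Y → Y → Prop) := IsWellFounded.wf
  let ind : Y → Y := fun y => wf.min {i | y ∈ O i} ⟨y, hy y⟩
  have hind : ∀ y, y ∈ O (ind y) := fun y => wf.min_mem {i | y ∈ O i} ⟨y, hy y⟩
  have hmin : ∀ y i, y ∈ O i → ¬ WellOrderingRel i (ind y) := fun y i hi =>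
    wf.not_lt_min {i | y ∈ O i} hi
  have hsymm : ∀ n : ℕ, ∀ c c' z : Y, ball c (3 * (1 / (n + 1 : ℝ))) ⊆ O (ind c) →
      z ∈ ball c (1 / (n + 1 : ℝ)) → z ∈ ball c' (1 / (n + 1 : ℝ)) →
      ¬ WellOrderingRel (ind c) (ind c') := by
    intro n c c' z hc h1 h2
    apply hmin
    apply hc
    have hp : 0 < 1 / (n + 1 : ℝ) := by positivity
    rw [mem_ball] at h1 h2 ⊢
    have := dist_triangle_left c' c z
    linarith
  refine ⟨fun n i => ⋃ c ∈ {c | ind c = i ∧ ball c (3 * (1 / (n + 1 : ℝ))) ⊆ O i},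
    ball c (1 / (n + 1 : ℝ)), ?_, ?_, ?_, ?_⟩
  · exact fun n i => isOpen_biUnion fun c _ => isOpen_ball
  · intro n i
    refine iUnion₂_subset fun c hc => ?_
    refine subset_trans (ball_subset_ball ?_) hc.2
    have hp : 0 < 1 / (n + 1 : ℝ) := by positivity
    linarith
  · intro n i i' z h h'
    obtain ⟨c, ⟨rfl, hc2⟩, hz⟩ := mem_iUnion₂.1 h
    obtain ⟨c', ⟨rfl, hc2'⟩, hz'⟩ := mem_iUnion₂.1 h'
    have h1 := hsymm n c c' z hc2 hz hz'
    have h2 := hsymm n c' c z hc2' hz' hz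
    rcases trichotomous_of WellOrderingRel (ind c) (ind c') with h | h | h
    · exact absurd h h1
    · exact h
    · exact absurd h h2
  · intro y
    obtain ⟨ε, hε, hb⟩ := Metric.isOpen_iff.1 (hO (ind y)) y (hind y)
    obtain ⟨n, hn⟩ := exists_nat_one_div_lt (show 0 < ε / 3 by linarith)
    refine ⟨n, ind y, mem_iUnion₂.2 ⟨y, ⟨rfl, subset_trans (ball_subset_ball ?_) hb⟩, ?_⟩⟩
    · linarith
    · exact mem_ball_self (by positivity)

/-- Local clopen decomposition of the fibers. -/
theorem local_parts {X Y : Type*} [MetricSpace X] [TopologicalSpace Y]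
    (f : X → Y) (hf : IsPerfectMap f) (hdim : DimMapLE f 0) (g α : X → ℝ) (hg : Continuous g)
    (hα : Continuous α) (hpos : ∀ x, 0 < α x) (ε : ℝ) (hε : 0 < ε) (y : Y) :
    ∃ V : Set Y, IsOpen V ∧ y ∈ V ∧ ∃ p : X → ℕ, ∃ c : ℕ → ℝ, ∃ η : ℝ, 0 < η ∧
      ContinuousOn p (f ⁻¹' V) ∧
      (∀ x x', f x ∈ V → f x' ∈ V → p x = p x' → dist x x' < ε) ∧
      ∀ x, f x ∈ V → |g x - c (p x)| + η ≤ α x := by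
  classical
  obtain ⟨hfc, hfcl, hfk⟩ := hf
  set F := f ⁻¹' {y} with hFdef
  have hF : IsCompact F := hfk y
  have : CompactSpace F := isCompact_iff_compactSpace.1 hF
  have hcov : CovDimLENat F 0 := by
    rcases hdim y with h | ⟨k, hk, h⟩
    · intro 𝒰 _ _ _
      have : IsEmpty F := h
      refine ⟨∅, by simp, ?_, by simp, by simp⟩
      exact Subsingleton.elim _ _
    · have : k = 0 := by exact_mod_cast le_antisymm hk (by positivity)
      subst this
      exact h
  obtain ⟨a, ha, haF⟩ := hF.exists_forall_le' hα.continuousOn (a := 0) fun x _ => hpos x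
  let B : X → Set X := fun z => {x | dist x z < ε / 2 ∧ |g x - g z| < a / 4 ∧ a / 2 < α x}
  have hBo : ∀ z, IsOpen (B z) := by
    intro z
    have h1 : IsOpen {x | dist x z < ε / 2} := isOpen_lt (by fun_prop) (by fun_prop)
    have h2 : IsOpen {x | |g x - g z| < a / 4} := isOpen_lt (by fun_prop) (by fun_prop)
    have h3 : IsOpen {x | a / 2 < α x} := isOpen_lt (by fun_prop) (by fun_prop)
    exact h1.inter (h2.inter h3)
  have hBz : ∀ z ∈ F, z ∈ B z := fun z hz => by
    have := haF z hz
    refine ⟨by simpa using hε, by simpa using ha, by linarith⟩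
  obtain ⟨t, htc⟩ := hF.elim_nhds_subcover' (fun z _ => B z)
    (fun z hz => (hBo z).mem_nhds (hBz z hz)) 
  let 𝒰 : Set (Set F) := (fun z : F => ((↑) : F → X) ⁻¹' B z) '' (t : Set F)
  obtain ⟨𝒱, hVo, hVc, hVU, hVord⟩ := hcov 𝒰 (t.finite_toSet.image _) (by
      rintro _ ⟨z, _, rfl⟩
      exact (hBo z).preimage continuous_subtype_val) (by
      refine eq_univ_of_forall fun x => ?_
      obtain ⟨z, hz, hx⟩ := mem_iUnion₂.1 (htc x.2)
      exact ⟨_, ⟨z, hz, rfl⟩, hx⟩)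
  have hzz : ∀ V ∈ 𝒱, ∃ z : t, V ⊆ ((↑) : F → X) ⁻¹' B (z : F) := by
    intro V hV
    obtain ⟨_, ⟨z, hz, rfl⟩, h⟩ := hVU V hV
    exact ⟨⟨z, hz⟩, h⟩
  have huniq : ∀ x V V', V ∈ 𝒱 → V' ∈ 𝒱 → x ∈ V → x ∈ V' → V = V' := by
    intro x V V' hV hV' hx hx'
    exact (Set.ncard_le_one (hVord x).1).1 (hVord x).2 V ⟨hV, hx⟩ V' ⟨hV', hx'⟩
  have hzz' : ∃ zz : 𝒱 → t, ∀ V : 𝒱, (V : Set F) ⊆ ((↑) : F → X) ⁻¹' B (zz V : F) :=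
    ⟨fun V => (hzz V V.2).choose, fun V => (hzz V V.2).choose_spec⟩
  obtain ⟨zz, hzzB⟩ := hzz'
  let S : t → Set F := fun z => ⋃ V : {V : 𝒱 // zz V = z}, (V.1 : Set F)
  have hSo : ∀ z, IsOpen (S z) := fun z => isOpen_iUnion fun V => hVo _ V.1.2
  have hSd : ∀ z z' x, x ∈ S z → x ∈ S z' → z = z' := by
    intro z z' x hx hx'
    obtain ⟨⟨V, hV⟩, hxV⟩ := mem_iUnion.1 hx
    obtain ⟨⟨V', hV'⟩, hxV'⟩ := mem_iUnion.1 hx'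
    have : V = V' := Subtype.ext (huniq x _ _ V.2 V'.2 hxV hxV')
    rw [← hV, ← hV', this]
  have hSc : ∀ x, ∃ z, x ∈ S z := by
    intro x
    have : x ∈ ⋃₀ 𝒱 := by rw [hVc]; trivial
    obtain ⟨V, hV, hx⟩ := this
    exact ⟨zz ⟨V, hV⟩, mem_iUnion.2 ⟨⟨⟨V, hV⟩, rfl⟩, hx⟩⟩
  have hSB : ∀ z x, x ∈ S z → (x : X) ∈ B (z : F) := by
    intro z x hx
    obtain ⟨⟨V, hV⟩, hxV⟩ := mem_iUnion.1 hx
    rw [← hV]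
    exact hzzB V hxV
  have hScl : ∀ z, IsClosed (S z) := by
    intro z
    have : S z = (⋃ z' : {z' // z' ≠ z}, S z')ᶜ := by
      ext x
      simp only [mem_compl_iff, mem_iUnion, not_exists]
      constructor
      · exact fun hx z' hx' => z'.2 (hSd _ _ x hx' hx)
      · intro h
        obtain ⟨z', hz'⟩ := hSc x
        by_cases hne : z' = z
        · exact hne ▸ hz'
        · exact absurd hz' (h ⟨z', hne⟩)
    rw [this]
    exact (isOpen_iUnion fun z' : {z' // z' ≠ z} => hSo z'.1).isClosed_compl
  let K : t → Set X := fun z => ((↑) : F → X) '' S z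
  have hK : ∀ z, IsCompact (K z) := fun z => (hScl z).isCompact.image continuous_subtype_val
  have hKd : Pairwise (Function.onFun Disjoint fun z => 𝓝ˢ (K z)) := by
    intro z z' hne
    apply SeparatedNhds.disjoint_nhdsSet
    apply SeparatedNhds.of_isCompact_isCompact (hK z) (hK z')
    rw [Set.disjoint_left]
    rintro _ ⟨x, hx, rfl⟩ ⟨x', hx', hxx⟩
    rw [Subtype.val_injective hxx] at hx'
    exact hne (hSd _ _ _ hx hx')
  obtain ⟨s, hs, hsd⟩ := hKd.exists_mem_filter_of_disjoint
  let Q : t → Set X := fun z => interior (s z) ∩ B (z : F)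
  have hQo : ∀ z, IsOpen (Q z) := fun z => isOpen_interior.inter (hBo _)
  have hQd : ∀ z z' x, x ∈ Q z → x ∈ Q z' → z = z' := by
    intro z z' x hx hx'
    by_contra hne
    exact Set.disjoint_left.1 (hsd hne) (interior_subset hx.1) (interior_subset hx'.1)
  have hQF : ∀ x ∈ F, ∃ z, x ∈ Q z := by
    intro x hx
    obtain ⟨z, hz⟩ := hSc ⟨x, hx⟩
    exact ⟨z, subset_interior_iff_mem_nhdsSet.2 (hs z) ⟨_, hz, rfl⟩, hSB z _ hz⟩
  let V : Set Y := (f '' (⋃ z, Q z)ᶜ)ᶜ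
  have hVQ : ∀ x, f x ∈ V → ∃ z, x ∈ Q z := by
    intro x hx
    by_contra hcon
    exact hx ⟨x, fun h => hcon (mem_iUnion.1 h), rfl⟩
  obtain ⟨e, he⟩ := Countable.exists_injective_nat t
  by_cases hne : Nonempty t
  swap
  · refine ⟨V, ?_, ?_, fun _ => 0, fun _ => 0, 1, one_pos, continuousOn_const, ?_, ?_⟩
    · exact (hfcl _ (isOpen_iUnion hQo).isClosed_compl).isOpen_compl
    · rintro ⟨x, hx, hxy⟩
      obtain ⟨z, hz⟩ := hQF x hxy
      exact hne ⟨z⟩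
    · intro x _ h _ _
      exact absurd ⟨(hVQ x h).choose⟩ hne
    · intro x h
      exact absurd ⟨(hVQ x h).choose⟩ hne
  choose! w hw using hVQ
  refine ⟨V, ?_, ?_, fun x => e (w x), fun n => g ((Function.invFun e n : t) : F), a / 4,
    by linarith, ?_, ?_, ?_⟩
  · exact (hfcl _ (isOpen_iUnion hQo).isClosed_compl).isOpen_compl
  · rintro ⟨x, hx, hxy⟩
    exact hx (mem_iUnion.2 (hQF x hxy))
  · intro x hx
    have hc0 : ContinuousWithinAt (fun _ : X => e (w x)) (f ⁻¹' V) x := continuousWithinAt_const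
    refine hc0.congr_of_eventuallyEq ?_ rfl
    have h1 : ∀ᶠ x' in 𝓝[f ⁻¹' V] x, x' ∈ Q (w x) :=
      mem_nhdsWithin_of_mem_nhds ((hQo _).mem_nhds (hw x hx))
    filter_upwards [h1, self_mem_nhdsWithin] with x' h1 h2
    rw [hQd _ _ x' h1 (hw x' h2)]
  · intro x x' hx hx' hp
    have h1 := (hw x hx).2.1
    have h2 := (hw x' hx').2.1
    rw [← he hp] at h2
    have := dist_triangle_right x x' ((w x : F) : X)
    linarith
  · intro x hx
    have h1 := (hw x hx).2.2
    simp only [Function.leftInverse_invFun he (w x)]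
    linarith [h1.1, h1.2]

/-- The Baire argument for the source limitation topology. -/
theorem baire_source {X : Type*} [TopologicalSpace X] (G : ℕ → Set (X →ᵇ ℝ))
    (hop : ∀ n, IsOpen[sourceLimitation X ℝ] (G n))
    (hd : ∀ n, ∀ g : X →ᵇ ℝ, ∀ α : X → ℝ, Continuous α → (∀ x, 0 < α x) →
      ∃ h ∈ G n, ∀ x, dist (h x) (g x) ≤ α x)
    (g : X →ᵇ ℝ) (α : X → ℝ) (hα : Continuous α) (hpos : ∀ x, 0 < α x) :
    ∃ h : X →ᵇ ℝ, (∀ n, h ∈ G n) ∧ ∀ x, dist (h x) (g x) ≤ α x := by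
  let St := {p : (X →ᵇ ℝ) × (X → ℝ) // Continuous p.2 ∧ ∀ x, 0 < p.2 x}
  have step : ∀ (n : ℕ) (s : St), ∃ s' : St, (∀ x, dist (s'.1.1 x) (s.1.1 x) ≤ s.1.2 x / 2) ∧
      (∀ x, s'.1.2 x ≤ s.1.2 x / 2) ∧
      ∀ h : X →ᵇ ℝ, (∀ x, dist (h x) (s'.1.1 x) ≤ s'.1.2 x) → h ∈ G n := by
    rintro n ⟨⟨g, α⟩, hα, hpos⟩
    obtain ⟨h, hG, hh⟩ := hd n g (fun x => α x / 2) (hα.div_const 2) (fun x => half_pos (hpos x))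
    obtain ⟨β, hβ, hβp, hβG⟩ := hop n h hG
    refine ⟨⟨⟨h, fun x => min (α x / 2) (β x)⟩, (hα.div_const 2).min hβ,
      fun x => lt_min (half_pos (hpos x)) (hβp x)⟩, hh, fun x => min_le_left _ _, ?_⟩
    exact fun h' hh' => hβG h' fun x => (hh' x).trans (min_le_right _ _)
  choose F hF1 hF2 hF3 using step
  let s0 : St := ⟨⟨g, fun x => min (α x) 1⟩, hα.min continuous_const,
    fun x => lt_min (hpos x) one_pos⟩
  let seq : ℕ → St := fun n => Nat.rec s0 (fun n s => F n s) n
  have hs0 : seq 0 = s0 := rfl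
  have hss : ∀ n, seq (n + 1) = F n (seq n) := fun n => rfl
  have hle : ∀ n x, (seq n).1.2 x ≤ (1 / 2 : ℝ) ^ n := by
    intro n x
    induction n with
    | zero => rw [hs0]; exact (min_le_right (α x) 1).trans (by simp)
    | succ n ih =>
      rw [hss, pow_succ]
      have := hF2 n (seq n) x
      linarith
  have hnest : ∀ n j x, n ≤ j →
      dist ((seq j).1.1 x) ((seq n).1.1 x) + (seq j).1.2 x ≤ (seq n).1.2 x := by
    intro n j x hnj
    induction j, hnj using Nat.le_induction with
    | base => simp
    | succ j hj ih =>
      rw [hss]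
      have h1 := hF1 j (seq j) x
      have h2 := hF2 j (seq j) x
      have h3 := dist_triangle ((F j (seq j)).1.1 x) ((seq j).1.1 x) ((seq n).1.1 x)
      linarith
  have hcau : CauchySeq fun n => (seq n).1.1 := by
    refine cauchySeq_of_le_geometric (1 / 2) 1 (by norm_num) fun n => ?_
    rw [BoundedContinuousFunction.dist_le (by positivity)]
    intro x
    have h1 := hnest n (n + 1) x (Nat.le_succ n)
    have h2 := hle n x
    have h3 := (seq (n + 1)).2.2 x
    rw [dist_comm]
    linarith
  obtain ⟨h, hh⟩ := cauchySeq_tendsto_of_complete hcau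
  have hlim : ∀ n x, dist (h x) ((seq n).1.1 x) ≤ (seq n).1.2 x := by
    intro n x
    have ht : Filter.Tendsto (fun j => (seq j).1.1 x) Filter.atTop (𝓝 (h x)) :=
      ((continuous_eval_const (F := X →ᵇ ℝ) x).tendsto h).comp hh
    refine le_of_tendsto (ht.dist tendsto_const_nhds) ?_
    filter_upwards [Filter.eventually_ge_atTop n] with j hj
    have h1 := hnest n j x hj
    have h3 := (seq j).2.2 x
    linarith
  refine ⟨h, fun n => ?_, fun x => ?_⟩
  · exact hF3 n (seq n) h (hlim (n + 1))
  · exact (hlim 0 x).trans (min_le_left _ _)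

/-- No `k+2` points `ε`-apart in one fiber of `f × h`. -/
def SepCond {X Y : Type*} [MetricSpace X] (f : X → Y) (k : ℕ) (ε : ℝ) (h : X → ℝ) : Prop :=
  ∀ x : Fin (k + 2) → X, (∀ a b, f (x a) = f (x b)) → (∀ a b, a ≠ b → ε ≤ dist (x a) (x b)) →
    ∃ a b, h (x a) ≠ h (x b)

theorem isOpen_sepCond {X Y : Type*} [MetricSpace X] [MetricSpace Y] (f : X → Y)
    (hf : IsPerfectMap f) (k : ℕ) (ε : ℝ) :
    IsOpen[sourceLimitation X ℝ] {g : X →ᵇ ℝ | SepCond f k ε g} := by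
  intro g hg
  obtain ⟨hfc, hfcl, hfk⟩ := hf
  have hprop : IsProperMap f := isProperMap_iff_isClosedMap_and_compact_fibers.2
    ⟨hfc, hfcl, hfk⟩
  have hpi : IsProperMap (fun (x : Fin (k + 2) → X) a => f (x a)) :=
    IsProperMap.pi_map (fun _ => hprop)
  let t : Y → Set ℝ := fun y => {r | 0 < r ∧ ∀ x : Fin (k + 2) → X, (∀ a, f (x a) = y) →
    (∀ a b, a ≠ b → ε ≤ dist (x a) (x b)) → ∃ a b, 3 * r < |g (x a) - g (x b)|}
  have hconv : ∀ y, Convex ℝ (t y) := by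
    intro y
    refine Set.OrdConnected.convex ⟨?_⟩
    rintro r ⟨hr, _⟩ s ⟨_, hs⟩ u ⟨hu1, hu2⟩
    refine ⟨hr.trans_le hu1, fun x h1 h2 => ?_⟩
    obtain ⟨a, b, hab⟩ := hs x h1 h2
    exact ⟨a, b, by linarith⟩
  have hloc : ∀ y, ∃ r, ∀ᶠ y' in 𝓝 y, r ∈ t y' := by
    intro y
    let O : ℕ → Set (Fin (k + 2) → X) := fun n =>
      (⋃ a, ⋃ b, ⋃ _ : a ≠ b, {x | dist (x a) (x b) < ε}) ∪
      ⋃ a, ⋃ b, {x | 3 * (1 / (n + 1 : ℝ)) < |g (x a) - g (x b)|}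
    have hO : ∀ n, IsOpen (O n) := by
      intro n
      refine IsOpen.union ?_ ?_
      · exact isOpen_iUnion fun a => isOpen_iUnion fun b => isOpen_iUnion fun _ =>
          isOpen_lt (by fun_prop) (by fun_prop)
      · exact isOpen_iUnion fun a => isOpen_iUnion fun b =>
          isOpen_lt (by fun_prop) (by fun_prop)
    have hOm : Monotone O := by
      intro n n' hn
      refine union_subset_union_right _ (iUnion_mono fun a => iUnion_mono fun b => ?_)
      intro x hx
      have : (1 / (n' + 1 : ℝ)) ≤ 1 / (n + 1 : ℝ) :=
        one_div_le_one_div_of_le (by positivity) (by exact_mod_cast Nat.succ_le_succ hn)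
      simp only [mem_ofPred_eq] at hx ⊢
      linarith
    have hK : IsCompact ((fun (x : Fin (k + 2) → X) a => f (x a)) ⁻¹' {fun _ => y}) :=
      hpi.isCompact_preimage isCompact_singleton
    obtain ⟨n, hn⟩ := hK.elim_directed_cover O hO (by
      intro x hx
      have hx' : ∀ a, f (x a) = y := fun a => congrFun hx a
      by_cases hd : ∀ a b, a ≠ b → ε ≤ dist (x a) (x b)
      · obtain ⟨a, b, hab⟩ := hg x (fun a b => by rw [hx', hx']) hd
        have : 0 < |g (x a) - g (x b)| := abs_pos.2 (sub_ne_zero.2 hab)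
        obtain ⟨n, hn⟩ := exists_nat_one_div_lt (show 0 < |g (x a) - g (x b)| / 3 by linarith)
        refine mem_iUnion.2 ⟨n, Or.inr (mem_iUnion₂.2 ⟨a, b, ?_⟩)⟩
        simp only [mem_ofPred_eq]
        linarith
      · push Not at hd
        obtain ⟨a, b, hab, hlt⟩ := hd
        exact mem_iUnion.2 ⟨0, Or.inl (mem_iUnion₂.2 ⟨a, b, mem_iUnion.2 ⟨hab, hlt⟩⟩)⟩)
      hOm.directed_le
    refine ⟨1 / (n + 1 : ℝ), ?_⟩
    have hcl : IsClosed ((fun (x : Fin (k + 2) → X) a => f (x a)) '' (O n)ᶜ) :=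
      hpi.isClosedMap _ (hO n).isClosed_compl
    have hdiag : Continuous (fun (y : Y) (_ : Fin (k + 2)) => y) := by fun_prop
    have hopen := hcl.isOpen_compl.preimage hdiag
    refine Filter.mem_of_superset (hopen.mem_nhds ?_) ?_
    · rintro ⟨x, hx, hxy⟩
      exact hx (hn hxy)
    · intro y' hy'
      refine ⟨by positivity, fun x hx hd => ?_⟩
      have hxO : x ∈ O n := by
        by_contra hcon
        exact hy' ⟨x, hcon, funext hx⟩
      rcases hxO with h | h
      · obtain ⟨a, b, h⟩ := mem_iUnion₂.1 h
        obtain ⟨hab, h⟩ := mem_iUnion.1 h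
        exact absurd (hd a b hab) (not_le.2 h)
      · obtain ⟨a, b, h⟩ := mem_iUnion₂.1 h
        exact ⟨a, b, h⟩
  obtain ⟨r, hr⟩ := exists_continuous_forall_mem_convex_of_local_const hconv hloc
  refine ⟨fun x => r (f x), r.continuous.comp hfc, fun x => (hr (f x)).1, fun h hh x hx hd => ?_⟩
  obtain ⟨a, b, hab⟩ := (hr (f (x 0))).2 x (fun a => hx a 0) hd
  refine ⟨a, b, fun heq => ?_⟩
  have h1 : _ ≤ r (f (x a)) := hh (x a)
  have h2 : _ ≤ r (f (x b)) := hh (x b)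
  rw [hx a 0, Real.dist_eq] at h1
  rw [hx b 0, Real.dist_eq] at h2
  have hp := (hr (f (x 0))).1
  have : |g (x a) - g (x b)| ≤ 2 * r (f (x 0)) := by
    rw [abs_le] at *
    constructor <;> linarith [h1.1, h1.2, h2.1, h2.2]
  linarith

/-- The density step. -/
theorem dense_step {X Y : Type*} [MetricSpace X] [MetricSpace Y] (f : X → Y)
    (hf : IsPerfectMap f) (hdim : DimMapLE f 0) (k : ℕ) (hY : CovDimLENat Y k)
    (ε : ℝ) (hε : 0 < ε) (g : X →ᵇ ℝ) (α : X → ℝ) (hα : Continuous α) (hpos : ∀ x, 0 < α x) :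
    ∃ h : X →ᵇ ℝ, SepCond f k ε h ∧ ∀ x, dist (h x) (g x) ≤ α x := by
  classical
  choose O hO hyO p c η hη hpc hpd hpg using
    local_parts f hf hdim g (fun x => min (α x) 1) g.continuous (hα.min continuous_const)
      (fun x => lt_min (hpos x) one_pos) ε hε
  obtain ⟨U, hUo, hUO, hUd, hUc⟩ := sigma_disjoint O hO hyO
  obtain ⟨W, hWo, hWc, hWlf, hWU⟩ := precise_refinement (fun n => ⋃ i, U n i)
    (fun n => isOpen_iUnion (hUo n)) (by
      refine eq_univ_of_forall fun y => ?_
      obtain ⟨n, i, h⟩ := hUc y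
      exact mem_iUnion₂.2 ⟨n, i, h⟩)
  obtain ⟨V, hVo, hVc, hVW, hVk⟩ := shrink_order hY W hWo
    (fun y => mem_iUnion.1 (by rw [hWc]; trivial)) hWlf
  have hVlf : LocallyFinite V := hWlf.subset hVW
  obtain ⟨φ, hφ⟩ := PartitionOfUnity.exists_isSubordinate_of_locallyFinite isClosed_univ V hVo
    hVlf (fun y _ => mem_iUnion.2 (hVc y))
  have hφV : ∀ n y, φ n y ≠ 0 → y ∈ V n := fun n y h => hφ n (subset_closure h)
  obtain ⟨b, hb, hbd⟩ := exists_generic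
  choose j hj using fun (n : ℕ) (i : Y) (q : ℕ) => hbd n q (c i q) (η i) (hη i)
  have hI : ∀ n y, ∃ i, y ∈ V n → y ∈ U n i := by
    intro n y
    by_cases h : y ∈ V n
    · obtain ⟨i, hi⟩ := mem_iUnion.1 (hWU n (hVW n h))
      exact ⟨i, fun _ => hi⟩
    · exact ⟨y, fun h' => absurd h' h⟩
  choose I hI using hI
  let idx : ℕ → X → ℕ × ℕ × ℕ := fun n x =>
    (n, p (I n (f x)) x, j n (I n (f x)) (p (I n (f x)) x))
  let hn : ℕ → X → ℝ := fun n x => b (idx n x)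
  have hncont : ∀ n, ContinuousOn (hn n) (f ⁻¹' V n) := by
    intro n x hx
    have hxU := hI n (f x) hx
    have hev : ∀ᶠ x' in 𝓝[f ⁻¹' V n] x, f x' ∈ U n (I n (f x)) :=
      mem_nhdsWithin_of_mem_nhds (((hUo n _).preimage hf.1).mem_nhds hxU)
    have h1 : ContinuousAt (p (I n (f x))) x :=
      (hpc (I n (f x))).continuousAt (((hO _).preimage hf.1).mem_nhds (hUO n _ hxU))
    have h2 : ContinuousAt (fun x' => b (n, p (I n (f x)) x',
        j n (I n (f x)) (p (I n (f x)) x'))) x :=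
      (continuous_of_discreteTopology (f := fun q : ℕ =>
        b (n, q, j n (I n (f x)) q))).continuousAt.comp h1
    refine h2.continuousWithinAt.congr_of_eventuallyEq ?_ rfl
    filter_upwards [hev, self_mem_nhdsWithin] with x' h3 h4
    have : I n (f x') = I n (f x) := hUd n _ _ _ (hI n (f x') h4) h3
    simp only [hn, idx, this]
  have hnclose : ∀ n x, f x ∈ V n → hn n x ∈ closedBall (g x) (min (α x) 1) := by
    intro n x hx
    have h1 := hpg (I n (f x)) x (hUO _ _ (hI n (f x) hx))
    have h2 := hj n (I n (f x)) (p (I n (f x)) x)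
    rw [mem_closedBall, Real.dist_eq]
    have h3 := abs_sub_le (hn n x) (c (I n (f x)) (p (I n (f x)) x)) (g x)
    rw [abs_sub_comm (c (I n (f x)) (p (I n (f x)) x)) (g x)] at h3
    have h4 : |hn n x - c (I n (f x)) (p (I n (f x)) x)| < η (I n (f x)) := h2
    linarith
  let ψ : PartitionOfUnity ℕ X univ :=
    { toFun := fun n => (φ n).comp ⟨f, hf.1⟩
      locallyFinite' := φ.locallyFinite.preimage_continuous hf.1
      nonneg' := fun n x => φ.nonneg n (f x)
      sum_eq_one' := fun x _ => φ.sum_eq_one (mem_univ (f x))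
      sum_le_one' := fun x => φ.sum_le_one (f x) }
  have hψ : ∀ n x, ψ n x = φ n (f x) := fun n x => rfl
  have hψs : ψ.IsSubordinate (fun n => f ⁻¹' V n) := by
    intro n
    have : tsupport (ψ n) ⊆ f ⁻¹' tsupport (φ n) :=
      closure_minimal (fun x hx => subset_closure hx) ((isClosed_tsupport _).preimage hf.1)
    exact this.trans (preimage_mono (hφ n))
  have hcont := hψs.continuous_finsum_smul (fun n => (hVo n).preimage hf.1) hncont
  have hclose : ∀ x, (∑ᶠ n, ψ n x • hn n x) ∈ closedBall (g x) (min (α x) 1) := fun x =>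
    ψ.finsum_smul_mem_convex (mem_univ x) (fun n h => hnclose n x (hφV n _ h))
      (convex_closedBall _ _)
  let h : X →ᵇ ℝ := BoundedContinuousFunction.ofNormedAddCommGroup
    (fun x => ∑ᶠ n, ψ n x • hn n x) hcont (‖g‖ + 1) (by
      intro x
      have h1 := hclose x
      rw [mem_closedBall, dist_eq_norm] at h1
      have h2 := g.norm_coe_le_norm x
      have h3 := norm_le_norm_add_norm_sub' (∑ᶠ n, ψ n x • hn n x) (g x)
      have h4 := min_le_right (α x) 1
      linarith)
  have hh : ∀ x, h x = ∑ᶠ n, ψ n x • hn n x := fun x => rfl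
  refine ⟨h, ?_, fun x => ?_⟩
  swap
  · rw [hh]
    exact (mem_closedBall.1 (hclose x)).trans (min_le_left _ _)
  intro x hx hd
  by_contra! hcon
  set y := f (x 0) with hy
  have hfin : {n | φ n y ≠ 0}.Finite := φ.locallyFinite.point_finite y
  let A : Finset ℕ := hfin.toFinset
  have hA : ∀ n, n ∈ A ↔ φ n y ≠ 0 := fun n => by simp [A]
  have hcard : A.card ≤ k + 1 := by
    by_contra! hlt
    obtain ⟨T, hTA, hT⟩ := Finset.exists_subset_card_eq (show k + 2 ≤ A.card from hlt)
    obtain ⟨n, hnT, hyn⟩ := hVk T hT y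
    exact hyn (hφV n y ((hA n).1 (hTA hnT)))
  obtain ⟨e⟩ : Nonempty (Option A ↪ Fin (k + 2)) :=
    Function.Embedding.nonempty_of_card_le (by simpa using hcard)
  have hfx : ∀ a, f (x a) = y := fun a => hx a 0
  have hinj : Function.Injective (fun q : Option A × A => idx q.2 (x (e q.1))) := by
    rintro ⟨a, n⟩ ⟨a', n'⟩ heq
    simp only [idx, Prod.mk.injEq, hfx] at heq
    obtain ⟨h1, h2, -⟩ := heq
    have h1 : n = n' := Subtype.ext h1
    subst h1
    have hyV : y ∈ V n := hφV n y ((hA n).1 n.2)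
    have hyO' : y ∈ O (I n y) := hUO _ _ (hI n y hyV)
    have h3 := hpd (I n y) (x (e a)) (x (e a')) (by rw [hfx]; exact hyO')
      (by rw [hfx]; exact hyO') h2
    have h4 : e a = e a' := by
      by_contra hne
      exact absurd (hd _ _ hne) (not_le.2 h3)
    rw [e.injective h4]
  refine generic_ne (A := A) (fun q => b (idx q.2 (x (e q.1)))) (hb.comp _ hinj)
    (fun n => φ n y) (h (x 0)) ?_ ?_
  · have h1 := φ.sum_eq_one (mem_univ y)
    rw [finsum_eq_sum_of_support_subset (s := A) _ (fun n hn => by simpa [hA] using hn)] at h1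
    rw [← h1]
    exact Finset.sum_coe_sort A (fun n => φ n y)
  · intro a
    rw [hcon 0 (e a), hh]
    simp only [hψ, hfx, smul_eq_mul]
    rw [finsum_eq_sum_of_support_subset (s := A) _ (fun n hn => by
      have := left_ne_zero_of_mul hn
      simpa [hA] using this)]
    exact Finset.sum_coe_sort A (fun n => φ n y * hn n (x (e a)))

/-- (Proposition 3.1) For a perfect 0-dimensional map `f : X → Y` with
`dim Y ≤ m`, the space `C*(X)` contains a dense `G_δ`-subset of maps `g` such that each
fiber of `f × g` contains at most `m + 1` points. -/
theorem statement6 {X Y : Type*} [TopologicalSpace X] [TopologicalSpace.MetrizableSpace X]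
    [TopologicalSpace Y] [TopologicalSpace.MetrizableSpace Y]
    (m : ℕ) (f : X → Y) (hf : IsPerfectMap f)
    (hfdim : DimMapLE f 0) (hdimY : CovDimLE Y m) :
    ∃ G : Set (X →ᵇ ℝ),
      @Dense _ (sourceLimitation X ℝ) G ∧ @IsGδ _ (sourceLimitation X ℝ) G ∧
      ∀ g ∈ G, ∀ z : Y × ℝ, ∀ S : Finset X, (∀ x ∈ S, (f x, g x) = z) →
        S.card ≤ m + 1 := by

  classical
  letI : MetricSpace X := TopologicalSpace.metrizableSpaceMetric X
  letI : MetricSpace Y := TopologicalSpace.metrizableSpaceMetric Y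
  rcases hdimY with hE | ⟨k, hkm, hk⟩
  · refine ⟨univ, @dense_univ _ (sourceLimitation X ℝ), @IsGδ.univ _ (sourceLimitation X ℝ), ?_⟩
    intro g _ z S _
    have : IsEmpty X := f.isEmpty
    simp [Finset.eq_empty_of_isEmpty S]
  have hkm' : k ≤ m := by exact_mod_cast hkm
  let G : ℕ → Set (X →ᵇ ℝ) := fun n => {g | SepCond f k (1 / (n + 1 : ℝ)) g}
  have hop : ∀ n, IsOpen[sourceLimitation X ℝ] (G n) := fun n => isOpen_sepCond f hf k _
  have hd : ∀ n, ∀ g : X →ᵇ ℝ, ∀ α : X → ℝ, Continuous α → (∀ x, 0 < α x) →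
      ∃ h ∈ G n, ∀ x, dist (h x) (g x) ≤ α x := by
    intro n g α hα hpos
    exact dense_step f hf hfdim k hk _ (by positivity) g α hα hpos
  refine ⟨⋂ n, G n, ?_, ?_, ?_⟩
  · rw [@dense_iff_inter_open _ (sourceLimitation X ℝ)]
    rintro U hU ⟨g, hg⟩
    obtain ⟨α, hα, hpos, hαU⟩ := hU g hg
    obtain ⟨h, hG, hh⟩ := baire_source G hop hd g α hα hpos
    exact ⟨h, hαU h hh, mem_iInter.2 hG⟩
  · exact @IsGδ.iInter_of_isOpen _ _ (sourceLimitation X ℝ) _ _ hop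
  · intro g hg z S hS
    by_contra! hlt
    obtain ⟨T, hTS, hT⟩ := Finset.exists_subset_card_eq (show k + 2 ≤ S.card by omega)
    let e := (T.equivFinOfCardEq hT).symm
    have hfin : ∃ n : ℕ, ∀ a b : Fin (k + 2), a ≠ b →
        1 / (n + 1 : ℝ) ≤ dist (e a : X) (e b) := by
      have h1 : ∀ q : Fin (k + 2) × Fin (k + 2), ∃ n : ℕ, q.1 ≠ q.2 →
          1 / (n + 1 : ℝ) ≤ dist (e q.1 : X) (e q.2) := by
        intro q
        by_cases hq : q.1 = q.2
        · exact ⟨0, fun h => absurd hq h⟩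
        · have : 0 < dist (e q.1 : X) (e q.2) :=
            dist_pos.2 fun h => hq (e.injective (Subtype.ext h))
          obtain ⟨n, hn⟩ := exists_nat_one_div_lt this
          exact ⟨n, fun _ => hn.le⟩
      choose n hn using h1
      refine ⟨Finset.univ.sup n, fun a b hab => le_trans ?_ (hn (a, b) hab)⟩
      have : n (a, b) ≤ Finset.univ.sup n := Finset.le_sup (Finset.mem_univ _)
      exact one_div_le_one_div_of_le (by positivity) (by exact_mod_cast Nat.succ_le_succ this)
    obtain ⟨n, hn⟩ := hfin
    have hz : ∀ a, (f (e a), g (e a)) = z := fun a => hS _ (hTS (e a).2)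
    obtain ⟨a, b, hab⟩ := mem_iInter.1 hg n (fun a => (e a : X))
      (fun a b => congrArg Prod.fst ((hz a).trans (hz b).symm)) hn
    exact hab (congrArg Prod.snd ((hz a).trans (hz b).symm))
end
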